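/- Fix a probability space (Ω, F, P) with a filtration (F_k)_{k≥0}, constants r ∈ (0,1), s, f, ŝ, f̂ > 0, t^{xy} ∈ (0,1], and α^x_0, β^x_0, α^y_0, β^y_0 > 0. Let α^x_k = α^x_0 + k·s·r and β^x_k = β^x_0 + k·f·(1−r), and let (T^x_k)_{k≥1}, (T^y_k)_{k≥0} be adapted real-valued processes such that: the law of T^x_k given F_{k−1} is Beta(α^x_k, β^x_k); the processes α^y, β^y satisfy α^y_k = α^y_{k−1} + ŝ·t^{xy}·max(T^x_k − T^y_{k−1}, 0) and β^y_k = β^y_{k−1} + f̂·t^{xy}·max(T^y_{k−1} − T^x_k, 0); and the conditional law of T^y_k given F_{k−1} and T^x_k is Beta(α^y_k, β^y_k). Then T^x_k − T^y_k converges to 0 in probability: for every ε > 0, lim_{k→∞} P(|T^x_k − T^y_k| > ε) = 0. -/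

import Mathlib

open MeasureTheory Filter

/-- The Beta(a,b) probability measure on ℝ: the measure supported on (0,1) with density
`x ↦ x^(a−1)·(1−x)^(b−1) / B(a,b)` with respect to Lebesgue measure, where
`B(a,b) = Γ(a)·Γ(b)/Γ(a+b)`. -/
noncomputable def betaMeasure (a b : ℝ) : Measure ℝ :=
  volume.withDensity fun x =>
    ENNReal.ofReal
      (if 0 < x ∧ x < 1 then
        x ^ (a - 1) * (1 - x) ^ (b - 1) / (Real.Gamma a * Real.Gamma b / Real.Gamma (a + b))
      else 0)

theorem tip_beta_eq (a b : ℝ) : betaMeasure a b = ProbabilityTheory.betaMeasure a b := by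
  unfold betaMeasure ProbabilityTheory.betaMeasure
  congr 1
  funext x
  rw [ProbabilityTheory.betaPDF_eq]
  congr 1
  split_ifs
  · unfold ProbabilityTheory.beta
    ring
  · rfl

theorem tip_beta_prob {a b : ℝ} (ha : 0 < a) (hb : 0 < b) :
    IsProbabilityMeasure (betaMeasure a b) := by
  rw [tip_beta_eq]
  exact ProbabilityTheory.isProbabilityMeasureBeta ha hb

theorem tip_beta_shift {a b : ℝ} (ha : 0 < a) (hb : 0 < b) (x : ℝ) :
    ENNReal.ofReal x * ProbabilityTheory.betaPDF a b x
      = ENNReal.ofReal (a / (a + b)) * ProbabilityTheory.betaPDF (a + 1) b x := by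
  rw [ProbabilityTheory.betaPDF_eq, ProbabilityTheory.betaPDF_eq]
  split_ifs with h
  · rw [← ENNReal.ofReal_mul h.1.le, ← ENNReal.ofReal_mul (by positivity)]
    congr 1
    unfold ProbabilityTheory.beta
    rw [Real.Gamma_add_one ha.ne', show a + 1 + b = (a + b) + 1 by ring,
      Real.Gamma_add_one (by positivity)]
    have h1 := Real.Gamma_pos_of_pos ha
    have h2 := Real.Gamma_pos_of_pos hb
    have h3 := Real.Gamma_pos_of_pos (add_pos ha hb)
    have h4 : x ^ (a + 1 - 1) = x * x ^ (a - 1) := by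
      rw [show a + 1 - 1 = (a - 1) + 1 by ring, Real.rpow_add_one h.1.ne']; ring
    rw [h4]
    field_simp
  · simp

theorem tip_meas_pdf (a b : ℝ) : Measurable (ProbabilityTheory.betaPDF a b) :=
  (ProbabilityTheory.measurable_betaPDFReal a b).ennreal_ofReal

theorem tip_beta_lint {a b : ℝ} (h : ℝ → ENNReal) (hh : Measurable h) :
    ∫⁻ x, h x ∂(betaMeasure a b) = ∫⁻ x, h x * ProbabilityTheory.betaPDF a b x := by
  rw [tip_beta_eq, ProbabilityTheory.betaMeasure,
    lintegral_withDensity_eq_lintegral_mul _ (tip_meas_pdf a b) hh]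
  simp [mul_comm]

theorem tip_beta_m1 {a b : ℝ} (ha : 0 < a) (hb : 0 < b) :
    ∫⁻ x, ENNReal.ofReal x ∂(betaMeasure a b) = ENNReal.ofReal (a / (a + b)) := by
  rw [tip_beta_lint _ (by fun_prop)]
  simp_rw [tip_beta_shift ha hb]
  rw [lintegral_const_mul _ (tip_meas_pdf _ _),
    ProbabilityTheory.lintegral_betaPDF_eq_one (by positivity) hb, mul_one]

theorem tip_beta_m2 {a b : ℝ} (ha : 0 < a) (hb : 0 < b) :
    ∫⁻ x, ENNReal.ofReal x * ENNReal.ofReal x ∂(betaMeasure a b)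
      = ENNReal.ofReal (a / (a + b) * ((a + 1) / (a + 1 + b))) := by
  rw [tip_beta_lint _ (by fun_prop)]
  simp_rw [mul_assoc, tip_beta_shift ha hb]
  simp_rw [mul_left_comm (ENNReal.ofReal _) (ENNReal.ofReal (a / (a + b))),
    tip_beta_shift (show 0 < a + 1 by positivity) hb]
  rw [lintegral_const_mul _ (by have := tip_meas_pdf (a+1+1) b; fun_prop),
    lintegral_const_mul _ (tip_meas_pdf _ _),
    ProbabilityTheory.lintegral_betaPDF_eq_one (by positivity) hb, mul_one,
    ← ENNReal.ofReal_mul (by positivity)]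

theorem tip_beta_supp (a b : ℝ) : betaMeasure a b (Set.Ioo 0 1)ᶜ = 0 := by
  rw [tip_beta_eq, ProbabilityTheory.betaMeasure, withDensity_apply _ measurableSet_Ioo.compl]
  rw [setLIntegral_eq_zero measurableSet_Ioo.compl]
  intro x hx
  rw [ProbabilityTheory.betaPDF_eq, if_neg (by simpa using hx)]
  simp

theorem tip_lint {Ω : Type*} {m mΩ : MeasurableSpace Ω} (hm : m ≤ mΩ) (P : Measure Ω)
    [IsProbabilityMeasure P] (T : Ω → ℝ) (hT : Measurable T) (M : Ω → Measure ℝ)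
    (hM : ∀ ω, IsProbabilityMeasure (M ω))
    (hc : ∀ A : Set ℝ, MeasurableSet A →
      P[fun ω => A.indicator (fun _ => (1 : ℝ)) (T ω) | m] =ᵐ[P] fun ω => (M ω A).toReal)
    (B : Set Ω) (hB : MeasurableSet[m] B) (h : ℝ → ENNReal) (hh : Measurable h) :
    AEMeasurable (fun ω => ∫⁻ x, h x ∂(M ω)) P ∧
      ∫⁻ ω in B, h (T ω) ∂P = ∫⁻ ω in B, ∫⁻ x, h x ∂(M ω) ∂P := by
  have key : ∀ A : Set ℝ, MeasurableSet A → AEMeasurable (fun ω => M ω A) P ∧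
      P (B ∩ T ⁻¹' A) = ∫⁻ ω in B, M ω A ∂P := by
    intro A hA
    have h1 : AEMeasurable (fun ω => (M ω A).toReal) P :=
      (integrable_condExp.1.congr (hc A hA)).aemeasurable
    have h2 : (fun ω => M ω A) = fun ω => ENNReal.ofReal (M ω A).toReal := by
      funext ω
      rw [ENNReal.ofReal_toReal (measure_ne_top _ _)]
    have hint : Integrable (fun ω => A.indicator (fun _ => (1 : ℝ)) (T ω)) P := by
      have : (fun ω => A.indicator (fun _ => (1 : ℝ)) (T ω)) = (T ⁻¹' A).indicator (fun _ => (1:ℝ)) := by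
        funext ω; rfl
      rw [this]
      exact (integrable_const _).indicator (hT hA)
    refine ⟨by rw [h2]; exact h1.ennreal_ofReal, ?_⟩
    have h3 := setIntegral_condExp hm hint hB
    rw [setIntegral_congr_ae (g := fun ω => (M ω A).toReal) (hm _ hB)
      ((hc A hA).mono fun ω hω _ => hω)] at h3
    rw [h2, ← ofReal_integral_eq_lintegral_ofReal, h3]
    · have : (fun ω => A.indicator (fun _ => (1 : ℝ)) (T ω)) = (T ⁻¹' A).indicator (fun _ => (1:ℝ)) := by
        funext ω; rfl
      rw [this, integral_indicator (hT hA), Measure.restrict_restrict (hT hA)]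
      simp [Set.inter_comm]
    · exact (integrable_condExp.congr (hc A hA)).integrableOn
    · exact Eventually.of_forall fun ω => ENNReal.toReal_nonneg
  refine Measurable.ennreal_induction (motive := fun h =>
    AEMeasurable (fun ω => ∫⁻ x, h x ∂(M ω)) P ∧
      ∫⁻ ω in B, h (T ω) ∂P = ∫⁻ ω in B, ∫⁻ x, h x ∂(M ω) ∂P) ?_ ?_ ?_ hh
  · intro c A hA
    have k := key A hA
    have e : ∀ ω, A.indicator (fun _ => c) (T ω) = (T ⁻¹' A).indicator (fun _ => c) ω := by
      intro ω; rfl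
    simp_rw [lintegral_indicator_const hA, e]
    refine ⟨k.1.const_mul c, ?_⟩
    rw [lintegral_indicator_const (hT hA), Measure.restrict_apply (hT hA), Set.inter_comm,
      lintegral_const_mul'' _ k.1.restrict, k.2]
  · intro f g _ hf hg ihf ihg
    have e : ∀ ω, ∫⁻ x, (f + g) x ∂(M ω) = ∫⁻ x, f x ∂(M ω) + ∫⁻ x, g x ∂(M ω) := by
      intro ω
      exact lintegral_add_left hf _
    simp_rw [e]
    refine ⟨ihf.1.add ihg.1, ?_⟩
    rw [lintegral_add_left' ihf.1.restrict, ← ihf.2, ← ihg.2]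
    exact lintegral_add_left (hf.comp hT) _
  · intro f hf hmono ih
    have e : ∀ ω, ∫⁻ x, ⨆ n, f n x ∂(M ω) = ⨆ n, ∫⁻ x, f n x ∂(M ω) := by
      intro ω
      exact lintegral_iSup hf hmono
    simp_rw [e]
    refine ⟨AEMeasurable.iSup fun n => (ih n).1, ?_⟩
    rw [lintegral_iSup' (fun n => (ih n).1.restrict), lintegral_iSup]
    · simp_rw [(ih _).2]
    · exact fun n => (hf n).comp hT
    · exact fun i j hij ω => hmono hij _
    · exact Eventually.of_forall fun ω i j hij => lintegral_mono (hmono hij)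

theorem tip_condExp_of {Ω : Type*} {m mΩ : MeasurableSpace Ω} (hm : m ≤ mΩ) (P : Measure Ω)
    [IsProbabilityMeasure P] (S g : Ω → ℝ) (hS : Integrable S P) (hS0 : 0 ≤ᵐ[P] S)
    (hg : Measurable[m] g) (hg0 : ∀ ω, 0 ≤ g ω) (hg1 : ∀ ω, g ω ≤ 1)
    (h : ∀ B, MeasurableSet[m] B →
      ∫⁻ ω in B, ENNReal.ofReal (S ω) ∂P = ∫⁻ ω in B, ENNReal.ofReal (g ω) ∂P)
    (Z : Ω → ℝ) (hZ : Measurable[m] Z) (hZS : Integrable (fun ω => Z ω * S ω) P) :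
    ∫ ω, Z ω * S ω ∂P = ∫ ω, Z ω * g ω ∂P := by
  have hgi : Integrable g P := by
    refine Integrable.of_bound (hg.mono hm le_rfl).aestronglyMeasurable 1 ?_
    exact Eventually.of_forall fun ω => by rw [Real.norm_eq_abs, abs_of_nonneg (hg0 ω)]; exact hg1 ω
  have hce : g =ᵐ[P] P[S | m] := by
    refine ae_eq_condExp_of_forall_setIntegral_eq hm hS (fun _ _ _ => hgi.integrableOn) ?_
      hg.stronglyMeasurable.aestronglyMeasurable
    intro B hB _
    rw [integral_eq_lintegral_of_nonneg_ae (Eventually.of_forall hg0) hgi.1.restrict,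
      integral_eq_lintegral_of_nonneg_ae (ae_restrict_of_ae hS0) hS.1.restrict, h B hB]
  have h1 := condExp_mul_of_stronglyMeasurable_left (f := Z) (g := S) hZ.stronglyMeasurable hZS hS
  calc ∫ ω, Z ω * S ω ∂P = ∫ ω, (P[Z * S | m]) ω ∂P := (integral_condExp hm).symm
    _ = ∫ ω, Z ω * g ω ∂P := by
      apply integral_congr_ae
      filter_upwards [h1, hce] with ω h1 h2
      rw [h1, Pi.mul_apply, h2]

/-- conditional moments -/
theorem tip_mom {Ω : Type*} {m mΩ : MeasurableSpace Ω} (hm : m ≤ mΩ) (P : Measure Ω)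
    [IsProbabilityMeasure P] (T : Ω → ℝ) (hT : Measurable T) (a b : Ω → ℝ)
    (ha : Measurable[m] a) (hb : Measurable[m] b) (ha0 : ∀ ω, 0 < a ω) (hb0 : ∀ ω, 0 < b ω)
    (hc : ∀ A : Set ℝ, MeasurableSet A →
      P[fun ω => A.indicator (fun _ => (1 : ℝ)) (T ω) | m]
        =ᵐ[P] fun ω => (betaMeasure (a ω) (b ω) A).toReal) :
    (∀ᵐ ω ∂P, 0 ≤ T ω ∧ T ω ≤ 1) ∧
    (∀ Z : Ω → ℝ, Measurable[m] Z → Integrable Z P →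
      ∫ ω, Z ω * T ω ∂P = ∫ ω, Z ω * (a ω / (a ω + b ω)) ∂P) ∧
    (∀ Z : Ω → ℝ, Measurable[m] Z → Integrable Z P →
      ∫ ω, Z ω * (T ω * T ω) ∂P
        = ∫ ω, Z ω * (a ω / (a ω + b ω) * ((a ω + 1) / (a ω + 1 + b ω))) ∂P) := by
  have hM : ∀ ω, IsProbabilityMeasure (betaMeasure (a ω) (b ω)) :=
    fun ω => tip_beta_prob (ha0 ω) (hb0 ω)
  have L := tip_lint hm P T hT (fun ω => betaMeasure (a ω) (b ω)) hM hc
  have hae : ∀ᵐ ω ∂P, T ω ∈ Set.Ioo (0:ℝ) 1 := by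
    have := (L Set.univ MeasurableSet.univ ((Set.Ioo (0:ℝ) 1)ᶜ.indicator fun _ => 1)
      (measurable_const.indicator measurableSet_Ioo.compl)).2
    simp_rw [lintegral_indicator_const measurableSet_Ioo.compl, tip_beta_supp] at this
    have e : ∀ ω, (Set.Ioo (0:ℝ) 1)ᶜ.indicator (fun _ => (1:ENNReal)) (T ω)
        = (T ⁻¹' (Set.Ioo (0:ℝ) 1)ᶜ).indicator (fun _ => 1) ω := by
      intro ω; rfl
    simp_rw [e] at this
    rw [lintegral_indicator_const (hT measurableSet_Ioo.compl)] at this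
    simp only [Measure.restrict_univ, one_mul, mul_zero, lintegral_zero] at this
    exact measure_eq_zero_iff_ae_notMem.1 this |>.mono fun ω h => by simpa using h
  have hbd : ∀ᵐ ω ∂P, 0 ≤ T ω ∧ T ω ≤ 1 := hae.mono fun ω h => ⟨h.1.le, h.2.le⟩
  have hTi : Integrable T P := by
    refine Integrable.of_bound hT.aestronglyMeasurable 1 ?_
    filter_upwards [hbd] with ω h
    rw [Real.norm_eq_abs, abs_of_nonneg h.1]; exact h.2
  have hTi2 : Integrable (fun ω => T ω * T ω) P := by
    refine Integrable.of_bound (hT.mul hT).aestronglyMeasurable 1 ?_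
    filter_upwards [hbd] with ω h
    rw [Real.norm_eq_abs, abs_of_nonneg (mul_nonneg h.1 h.1)]; nlinarith [h.1, h.2]
  refine ⟨hbd, ?_, ?_⟩
  · intro Z hZ hZi
    refine tip_condExp_of hm P T _ hTi (hbd.mono fun ω h => h.1) (ha.div (ha.add hb)) ?_ ?_ ?_ Z hZ ?_
    · intro ω; have := ha0 ω; have := hb0 ω; simp only [Pi.div_apply, Pi.add_apply]; positivity
    · intro ω; have := ha0 ω; have := hb0 ω; simp only [Pi.div_apply, Pi.add_apply]
      rw [div_le_one (by positivity)]; linarith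
    · intro B hB
      rw [(L B hB _ ENNReal.measurable_ofReal).2]
      simp_rw [tip_beta_m1 (ha0 _) (hb0 _)]
      rfl
    · refine hZi.mul_bdd (c := 1) hT.aestronglyMeasurable ?_
      filter_upwards [hbd] with ω h
      rw [Real.norm_eq_abs, abs_of_nonneg h.1]; exact h.2
  · intro Z hZ hZi
    refine tip_condExp_of hm P (fun ω => T ω * T ω) _ hTi2
      (hbd.mono fun ω h => mul_nonneg h.1 h.1)
      ((ha.div (ha.add hb)).mul ((ha.add_const 1).div ((ha.add_const 1).add hb))) ?_ ?_ ?_ Z hZ ?_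
    · intro ω; have := ha0 ω; have := hb0 ω
      simp only [Pi.div_apply, Pi.add_apply, Pi.mul_apply]; positivity
    · intro ω; have := ha0 ω; have := hb0 ω
      simp only [Pi.div_apply, Pi.add_apply, Pi.mul_apply]
      apply mul_le_one₀ _ (by positivity) _
      · rw [div_le_one (by positivity)]; linarith
      · rw [div_le_one (by positivity)]; linarith
    · intro B hB
      have := (L B hB (fun x => ENNReal.ofReal x * ENNReal.ofReal x) (by fun_prop)).2
      simp_rw [tip_beta_m2 (ha0 _) (hb0 _)] at this
      refine Eq.trans ?_ this
      apply lintegral_congr_ae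
      filter_upwards [ae_restrict_of_ae hbd] with ω h
      rw [ENNReal.ofReal_mul h.1]
    · refine hZi.mul_bdd (c := 1) (hT.mul hT).aestronglyMeasurable ?_
      filter_upwards [hbd] with ω h
      rw [Real.norm_eq_abs, abs_of_nonneg (mul_nonneg h.1 h.1)]; nlinarith [h.1, h.2]



noncomputable def tipq (δ u : ℝ) : ℝ := u - max (-δ) (min δ u)

theorem tipq_le {δ u h : ℝ} (hδ : 0 < δ) : (tipq δ (u + h)) ^ 2 ≤ (tipq δ u + h) ^ 2 := by
  unfold tipq
  have e : ∀ v : ℝ, v ≤ -δ ∧ max (-δ) (min δ v) = -δ ∨ (-δ ≤ v ∧ v ≤ δ) ∧ max (-δ) (min δ v) = v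
      ∨ δ ≤ v ∧ max (-δ) (min δ v) = δ := by
    intro v
    rcases le_total v (-δ) with h | h
    · left; refine ⟨h, ?_⟩; rw [min_eq_right (by linarith), max_eq_left h]
    · rcases le_total v δ with h' | h'
      · right; left; refine ⟨⟨h, h'⟩, ?_⟩; rw [min_eq_right h', max_eq_right h]
      · right; right; refine ⟨h', ?_⟩; rw [min_eq_left h', max_eq_right (by linarith)]
  rcases e u with ⟨h1, h2⟩ | ⟨h1, h2⟩ | ⟨h1, h2⟩ <;>
  rcases e (u + h) with ⟨h3, h4⟩ | ⟨h3, h4⟩ | ⟨h3, h4⟩ <;> rw [h2, h4] <;> 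
  nlinarith [sq_nonneg (u - u + h)]

theorem tipq_abs {δ : ℝ} (hδ : 0 < δ) (u : ℝ) :
    |tipq δ u| * |u| = tipq δ u ^ 2 + δ * |tipq δ u| ∧ |tipq δ u| ≤ |u| ∧
    (0 ≤ u → 0 ≤ tipq δ u) ∧ (u ≤ 0 → tipq δ u ≤ 0) ∧ u ^ 2 ≤ 2 * tipq δ u ^ 2 + 2 * δ ^ 2 := by
  unfold tipq
  rcases le_total u (-δ) with h | h
  · rw [min_eq_right (by linarith), max_eq_left h, abs_of_nonpos (by linarith : u ≤ 0),
      abs_of_nonpos (by linarith : u - -δ ≤ 0)]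
    refine ⟨by ring, by linarith, fun _ => by linarith, fun _ => by linarith, by nlinarith [sq_nonneg (u + 2 * δ)]⟩
  · rcases le_total u δ with h' | h'
    · rw [min_eq_right h', max_eq_right h]
      simp
      nlinarith
    · rw [min_eq_left h', max_eq_right (by linarith), abs_of_nonneg (by linarith : 0 ≤ u),
        abs_of_nonneg (by linarith : 0 ≤ u - δ)]
      refine ⟨by ring, by linarith, fun _ => by linarith, fun _ => by linarith, by nlinarith [sq_nonneg (u - 2 * δ)]⟩

theorem tip_nu {n0 C n n' : ℝ} (h0 : 0 < n0) (h1 : n0 ≤ n) (h2 : n ≤ n') (h3 : n' ≤ n + C) :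
    (n' - n) * (1 / n) ^ 2 ≤ (1 + C / n0) * (1 / n - 1 / n') := by
  have hn : 0 < n := by linarith
  have hn' : 0 < n' := by linarith
  have hK : n' ≤ (1 + C / n0) * n := by
    have : C ≤ C / n0 * n := by
      rw [div_mul_eq_mul_div, le_div_iff₀ h0]
      exact mul_le_mul_of_nonneg_left h1 (by linarith)
    linarith
  have e : (1 + C / n0) * (1 / n - 1 / n') = (n' - n) * ((1 + C / n0) * (1 / (n * n'))) := by
    field_simp
  rw [e]
  apply mul_le_mul_of_nonneg_left _ (by linarith)
  rw [mul_one_div, one_div_pow, div_le_div_iff₀ (by positivity) (by positivity)]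
  nlinarith

theorem tip_inc {c e c0 C X Y : ℝ} (hc0 : 0 < c0) (h1 : c0 ≤ c) (h2 : c0 ≤ e) (h3 : c ≤ C)
    (h4 : e ≤ C) (hX : 0 ≤ X ∧ X ≤ 1) (hY : 0 ≤ Y ∧ Y ≤ 1) :
    0 ≤ c * max (X - Y) 0 + e * max (Y - X) 0 ∧ c * max (X - Y) 0 + e * max (Y - X) 0 ≤ C ∧
    c0 * (X - Y) ^ 2 ≤ c * max (X - Y) 0 + e * max (Y - X) 0 := by
  obtain ⟨hX0, hX1⟩ := hX
  obtain ⟨hY0, hY1⟩ := hY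
  rcases le_total X Y with h | h
  · rw [max_eq_right (by linarith), max_eq_left (by linarith)]
    refine ⟨by nlinarith, by nlinarith, ?_⟩
    have : (X - Y) ^ 2 ≤ Y - X := by nlinarith
    nlinarith
  · rw [max_eq_left (by linarith), max_eq_right (by linarith)]
    refine ⟨by nlinarith, by nlinarith, ?_⟩
    have : (X - Y) ^ 2 ≤ X - Y := by nlinarith
    nlinarith

theorem tip_g {c e C κ p X Y m : ℝ} (hp : 0 < p) (hp1 : p < 1) (hc : 0 < c) (he : 0 < e)
    (h3 : c ≤ C) (h4 : e ≤ C) (hκ : 0 < κ) (hκ1 : κ ≤ (1 - p) * c) (hκ2 : κ ≤ p * e) (q : ℝ)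
    (hq0 : 0 ≤ m - p → 0 ≤ q) (hq1 : m - p ≤ 0 → q ≤ 0) :
    q * ((1 - p) * (c * max (X - Y) 0) - p * (e * max (Y - X) 0)) ≤
      |q| * (-κ * |m - p| + C * |X - p - (Y - m)|) := by
  set ξ := X - p - (Y - m) with hξ
  set u := m - p with hu
  have hd : X - Y = -u + ξ := by rw [hξ, hu]; ring
  have hd' : Y - X = u - ξ := by rw [hξ, hu]; ring
  rw [hd, hd']
  have a1 : (1 - p) * c ≤ C := by nlinarith
  have a2 : p * e ≤ C := by nlinarith
  rcases le_total 0 u with h | h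
  · rw [abs_of_nonneg (hq0 h), abs_of_nonneg h]
    apply mul_le_mul_of_nonneg_left _ (hq0 h)
    have b1 := le_abs_self ξ
    have b2 := abs_nonneg ξ
    rcases le_total u ξ with h' | h'
    · rw [max_eq_left (by linarith), max_eq_right (by linarith)]
      nlinarith
    · rw [max_eq_right (by linarith), max_eq_left (by linarith)]
      have : p * e * ξ ≤ C * |ξ| := by
        calc p * e * ξ ≤ p * e * |ξ| := by gcongr
          _ ≤ C * |ξ| := by gcongr
      nlinarith
  · have hq := hq1 h
    rw [abs_of_nonpos hq, abs_of_nonpos h]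
    have : ∀ x y : ℝ, -x ≤ y → q * x ≤ -q * y := fun x y h => by nlinarith
    apply this
    have b1 := neg_abs_le ξ
    have b2 := abs_nonneg ξ
    rcases le_total u ξ with h' | h'
    · rw [max_eq_left (by linarith), max_eq_right (by linarith)]
      have : (1 - p) * c * (-ξ) ≤ C * |ξ| := by
        calc (1 - p) * c * (-ξ) ≤ (1 - p) * c * |ξ| := by
              apply mul_le_mul_of_nonneg_left (by linarith); nlinarith
          _ ≤ C * |ξ| := by gcongr
      nlinarith
    · rw [max_eq_right (by linarith), max_eq_left (by linarith)]
      nlinarith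

theorem tip_xi {C κ δ : ℝ} (hκ : 0 < κ) (hδ : 0 < δ) (x y : ℝ) :
    C * |x - y| ≤ κ * δ / 2 + 2 * (C ^ 2 / (2 * κ * δ)) * x ^ 2
      + 2 * (C ^ 2 / (2 * κ * δ)) * y ^ 2 := by
  have hQ0 : 0 ≤ C ^ 2 / (2 * κ * δ) := by positivity
  have e1 : (x - y) ^ 2 ≤ 2 * x ^ 2 + 2 * y ^ 2 := by
    nlinarith [sq_nonneg (x + y)]
  have e2 : C * |x - y| ≤ κ * δ / 2 + C ^ 2 / (2 * κ * δ) * (x - y) ^ 2 := by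
    rw [← sq_abs (x - y)]
    have h1 : κ * δ / 2 + C ^ 2 / (2 * κ * δ) * |x - y| ^ 2 - C * |x - y|
        = (κ * δ - C * |x - y|) ^ 2 / (2 * κ * δ) := by
      field_simp; ring
    have : 0 ≤ (κ * δ - C * |x - y|) ^ 2 / (2 * κ * δ) := by positivity
    linarith
  have e3 := mul_le_mul_of_nonneg_left e1 hQ0
  linarith

set_option maxHeartbeats 800000 in
theorem tip_path {a b c e c0 C κ p δ n0 X Y : ℝ} (hp : 0 < p) (hp1 : p < 1) (hc0 : 0 < c0)
    (h1 : c0 ≤ c) (h2 : c0 ≤ e) (h3 : c ≤ C)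
    (h4 : e ≤ C) (hX : 0 ≤ X ∧ X ≤ 1) (hY : 0 ≤ Y ∧ Y ≤ 1) (hκ : 0 < κ)
    (hκ1 : κ ≤ (1 - p) * c) (hκ2 : κ ≤ p * e) (hδ : 0 < δ) (ha : 0 < a) (hb : 0 < b)
    (hn0 : 0 < n0) (hn : n0 ≤ a + b) {a' b' Q : ℝ} (ha' : a' = a + c * max (X - Y) 0)
    (hb' : b' = b + e * max (Y - X) 0) (hQ : Q = C ^ 2 / (2 * κ * δ)) :
    tipq δ (a' / (a' + b') - p) ^ 2 ≤ tipq δ (a / (a + b) - p) ^ 2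
      - 2 * κ * (1 / (a + b) * tipq δ (a / (a + b) - p) ^ 2)
      - κ * δ * (1 / (a + b) * |tipq δ (a / (a + b) - p)|)
      + 4 * Q * (1 / (a + b) * |tipq δ (a / (a + b) - p)| * (X - p) ^ 2)
      + 4 * Q * (1 / (a + b) * |tipq δ (a / (a + b) - p)| * (Y - a / (a + b)) ^ 2)
      + 8 * C * (1 + C / n0) * (1 / (a + b) - 1 / (a' + b')) := by
  obtain ⟨i1, i2, -⟩ := tip_inc hc0 h1 h2 h3 h4 hX hY
  have hcpos : 0 < c := by linarith
  have hepos : 0 < e := by linarith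
  have hCpos : 0 < C := by linarith
  set m := a / (a + b) with hm
  set q := tipq δ (m - p) with hq
  set g := (1 - p) * (c * max (X - Y) 0) - p * (e * max (Y - X) 0) with hg
  set n := a + b with hnn
  set n' := a' + b' with hnn'
  have hDn : n' - n = c * max (X - Y) 0 + e * max (Y - X) 0 := by rw [hnn, hnn', ha', hb']; ring
  set D := n' - n with hD
  have hnpos : 0 < n := by linarith
  have hn'pos : 0 < n' := by linarith
  have hm0 : 0 ≤ m := by positivity
  have hm1 : m ≤ 1 := by rw [hm, div_le_one hnpos]; linarith
  have hu : |m - p| ≤ 1 := by rw [abs_le]; constructor <;> linarith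
  obtain ⟨q1, q2, q3, q4, -⟩ := tipq_abs hδ (m - p)
  rw [← hq] at q1 q2 q3 q4
  have hqle : |q| ≤ 1 := q2.trans hu
  have hG := tip_g (X := X) (Y := Y) hp hp1 hcpos hepos h3 h4 hκ hκ1 hκ2 q q3 q4
  rw [← hg] at hG
  have hx0 : 0 ≤ c * max (X - Y) 0 := by positivity
  have hy0 : 0 ≤ e * max (Y - X) 0 := by positivity
  have hgD : |g| ≤ D := by
    rw [hDn, hg, abs_le]; constructor <;> nlinarith [mul_nonneg hp.le hx0, mul_nonneg hp.le hy0, mul_nonneg (sub_nonneg.2 hp1.le) hx0]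
  have hD0 : 0 ≤ D := by rw [hDn]; exact i1
  have hDC : D ≤ C := by rw [hDn]; exact i2
  have hν := tip_nu hn0 hn (show n ≤ n' by linarith) (show n' ≤ n + C by linarith)
  set ν := 1 / n with hνd
  set ν' := 1 / n' with hνd'
  have hν0 : 0 < ν := by positivity
  have hν'0 : 0 < ν' := by positivity
  have hνν' : ν' ≤ ν := one_div_le_one_div_of_le hnpos (by linarith)
  have hdiff : ν - ν' = D * ν * ν' := by rw [hνd, hνd', hD]; field_simp
  set G := g - (m - p) * D with hGd
  have hGabs : |G| ≤ 2 * D := by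
    calc |G| ≤ |g| + |(m - p) * D| := abs_sub _ _
      _ ≤ D + 1 * D := by
        rw [abs_mul, abs_of_nonneg hD0]
        gcongr
      _ = 2 * D := by ring
  have hh : a' / n' - p = (m - p) + G * ν' := by
    have ea : a' = n * m + c * max (X - Y) 0 := by rw [ha', hm]; field_simp
    have en : n' = n + D := by rw [hD]; ring
    have : a' - p * n' = (m - p) * n' + G := by
      rw [hGd, hg, ea, en, hDn]; ring
    rw [hνd']
    field_simp
    linarith
  rw [hh]
  have s1 := tipq_le (u := m - p) (h := G * ν') hδ
  rw [← hq] at s1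
  have habs2 : (G * ν') ^ 2 ≤ 4 * D ^ 2 * ν ^ 2 := by
    have : |G * ν'| ≤ 2 * D * ν := by
      rw [abs_mul, abs_of_pos hν'0]; gcongr
    calc (G * ν') ^ 2 = |G * ν'| ^ 2 := (sq_abs _).symm
      _ ≤ (2 * D * ν) ^ 2 := by gcongr
      _ = _ := by ring
  have hqG : q * G * ν' ≤ q * G * ν + 2 * D ^ 2 * ν ^ 2 := by
    have e1 : q * G * ν' = q * G * ν - q * G * (D * ν * ν') := by rw [← hdiff]; ring
    have : |q * G * (D * ν * ν')| ≤ 1 * (2 * D) * (D * ν * ν) := by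
      rw [abs_mul, abs_mul, abs_of_nonneg (show 0 ≤ D * ν * ν' by positivity)]
      gcongr
    have := neg_abs_le (q * G * (D * ν * ν'))
    rw [e1]
    linarith
  have hqu : 0 ≤ q * (m - p) := by
    rcases le_total 0 (m - p) with h | h
    · exact mul_nonneg (q3 h) h
    · exact mul_nonneg_of_nonpos_of_nonpos (q4 h) h
  have hqG2 : q * G * ν ≤ q * g * ν := by
    have : 0 ≤ q * (m - p) * D * ν := by positivity
    rw [hGd]; linarith
  have hD2 : 8 * D ^ 2 * ν ^ 2 ≤ 8 * C * (1 + C / n0) * (ν - ν') := by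
    have : D ^ 2 * ν ^ 2 ≤ C * (D * ν ^ 2) := by
      have h0 : 0 ≤ D * ν ^ 2 := by positivity
      have h1 := mul_le_mul_of_nonneg_right hDC h0
      linarith
    have h2 := mul_le_mul_of_nonneg_left hν hCpos.le
    linarith
  have hξ : C * |X - p - (Y - m)| ≤ κ * δ / 2 + 2 * Q * (X - p) ^ 2 + 2 * Q * (Y - m) ^ 2 := by
    rw [hQ]; exact tip_xi hκ hδ (X - p) (Y - m)
  have hfin : q * g * ν ≤ ν * (-κ * (q ^ 2 + δ * |q|) + |q| * (κ * δ / 2 + 2 * Q * (X - p) ^ 2 + 2 * Q * (Y - m) ^ 2)) := by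
    have : q * g ≤ -κ * (q ^ 2 + δ * |q|) + |q| * (κ * δ / 2 + 2 * Q * (X - p) ^ 2 + 2 * Q * (Y - m) ^ 2) := by
      rw [← q1]
      have := mul_le_mul_of_nonneg_left hξ (abs_nonneg q)
      linarith
    have h5 := mul_le_mul_of_nonneg_left this hν0.le
    linarith
  linarith

theorem tip_var {a b a0 b0 : ℝ} (ha0 : 0 < a0) (hb0 : 0 < b0) (ha : a0 ≤ a) (hb : b0 ≤ b) :
    a0 * b0 / (a0 + b0 + 1) * (1 / (a + b)) ^ 2 ≤
      a / (a + b) * ((a + 1) / (a + 1 + b)) - (a / (a + b)) ^ 2 ∧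
      a / (a + b) * ((a + 1) / (a + 1 + b)) - (a / (a + b)) ^ 2 ≤ 1 / (a + b) := by
  have hap : 0 < a := by linarith
  have hbp : 0 < b := by linarith
  have e : a / (a + b) * ((a + 1) / (a + 1 + b)) - (a / (a + b)) ^ 2
      = (a * b / (a + b + 1)) * (1 / (a + b)) ^ 2 := by
    have : a + 1 + b ≠ 0 := by positivity
    field_simp
    ring
  rw [e]
  constructor
  · apply mul_le_mul_of_nonneg_right _ (by positivity)
    rw [div_le_div_iff₀ (by positivity) (by positivity)]
    have h1 : a0 * b0 ≤ a * b := by gcongr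
    have h2 : a0 * b0 * a ≤ a * b * a0 := by nlinarith [mul_pos ha0 hap]
    have h3 : a0 * b0 * b ≤ a * b * b0 := by nlinarith [mul_pos hb0 hbp]
    nlinarith
  · rw [one_div_pow, mul_one_div, div_div, div_le_div_iff₀ (by positivity) (by positivity)]
    have : a * b ≤ (a + b) ^ 2 := by nlinarith
    nlinarith [mul_pos hap hbp, sq_nonneg (a+b)]


theorem tip_int {Ω : Type*} {mΩ : MeasurableSpace Ω} (P : Measure Ω)
    [IsProbabilityMeasure P] {f : Ω → ℝ} (hf : Measurable f) (c : ℝ) (h : ∀ᵐ ω ∂P, |f ω| ≤ c) :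
    Integrable f P :=
  Integrable.of_bound hf.aestronglyMeasurable c h

theorem tip_lin {Ω : Type*} {mΩ : MeasurableSpace Ω} {P : Measure Ω} {f g h : Ω → ℝ}
    (hf : Integrable f P) (hg : Integrable g P) (hh : Integrable h P) (x y z : ℝ) :
    Integrable (fun ω => x * f ω + y * g ω + z * h ω) P ∧
    ∫ ω, (x * f ω + y * g ω + z * h ω) ∂P = x * ∫ ω, f ω ∂P + y * ∫ ω, g ω ∂P + z * ∫ ω, h ω ∂P := by
  have i1 : Integrable (fun ω => x * f ω + y * g ω) P := (hf.const_mul x).add (hg.const_mul y)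
  refine ⟨i1.add (hh.const_mul z), ?_⟩
  rw [integral_add i1 (hh.const_mul z), integral_add (hf.const_mul x) (hg.const_mul y)]
  simp only [integral_const_mul]

theorem tip_step1 {Ω : Type*} {mG mF mΩ : MeasurableSpace Ω} (hGF : mG ≤ mF) (hF : mF ≤ mΩ)
    (P : Measure Ω) [IsProbabilityMeasure P] {c e c0 C a0 b0 μ1 μ2 : ℝ}
    (X Y a b a' b' : Ω → ℝ) (hXm : Measurable X) (hYm : Measurable[mF] Y)
    (ham : Measurable[mG] a) (hbm : Measurable[mG] b)
    (hc0 : 0 < c0) (h1 : c0 ≤ c) (h2 : c0 ≤ e) (h3 : c ≤ C) (h4 : e ≤ C)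
    (ha0 : 0 < a0) (hb0 : 0 < b0) (ha : ∀ ω, a0 ≤ a ω) (hb : ∀ ω, b0 ≤ b ω)
    (ha' : ∀ ω, a' ω = a ω + c * max (X ω - Y ω) 0)
    (hb' : ∀ ω, b' ω = b ω + e * max (Y ω - X ω) 0)
    (hX : ∀ᵐ ω ∂P, 0 ≤ X ω ∧ X ω ≤ 1) (hY : ∀ᵐ ω ∂P, 0 ≤ Y ω ∧ Y ω ≤ 1)
    (hμ : μ1 ^ 2 ≤ μ2)
    (hX1 : ∀ Z : Ω → ℝ, Measurable[mF] Z → Integrable Z P →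
      ∫ ω, Z ω * X ω ∂P = ∫ ω, Z ω * μ1 ∂P)
    (hX2 : ∀ Z : Ω → ℝ, Measurable[mF] Z → Integrable Z P →
      ∫ ω, Z ω * (X ω * X ω) ∂P = ∫ ω, Z ω * μ2 ∂P)
    (hY1 : ∀ Z : Ω → ℝ, Measurable[mG] Z → Integrable Z P →
      ∫ ω, Z ω * Y ω ∂P = ∫ ω, Z ω * (a ω / (a ω + b ω)) ∂P)
    (hY2 : ∀ Z : Ω → ℝ, Measurable[mG] Z → Integrable Z P →
      ∫ ω, Z ω * (Y ω * Y ω) ∂P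
        = ∫ ω, Z ω * (a ω / (a ω + b ω) * ((a ω + 1) / (a ω + 1 + b ω))) ∂P) :
    c0 * (a0 * b0 / (a0 + b0 + 1)) * ∫ ω, (1 / (a ω + b ω)) ^ 4 ∂P ≤
      (1 + C / (a0 + b0)) * (∫ ω, 1 / (a ω + b ω) ∂P - ∫ ω, 1 / (a' ω + b' ω) ∂P) := by
  have hG := hGF.trans hF
  have hapos : ∀ ω, 0 < a ω := fun ω => ha0.trans_le (ha ω)
  have hbpos : ∀ ω, 0 < b ω := fun ω => hb0.trans_le (hb ω)
  have hnpos : ∀ ω, 0 < a ω + b ω := fun ω => add_pos (hapos ω) (hbpos ω)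
  have aM : Measurable a := ham.mono hG le_rfl
  have bM : Measurable b := hbm.mono hG le_rfl
  have YM : Measurable Y := hYm.mono hF le_rfl
  have a'M : Measurable a' := by
    rw [funext ha']; fun_prop
  have b'M : Measurable b' := by
    rw [funext hb']; fun_prop
  set ν : Ω → ℝ := fun ω => 1 / (a ω + b ω) with hν
  have νG : Measurable[mG] ν := by
    exact measurable_const.div (ham.add hbm)
  have νM : Measurable ν := νG.mono hG le_rfl
  have ν0 : ∀ ω, 0 < ν ω := fun ω => one_div_pos.2 (hnpos ω)
  set R := 1 / (a0 + b0) with hR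
  have hR0 : 0 < R := by positivity
  have νR : ∀ ω, ν ω ≤ R := fun ω =>
    one_div_le_one_div_of_le (by positivity) (add_le_add (ha ω) (hb ω))
  have νint : ∀ k : ℕ, Integrable (fun ω => ν ω ^ k) P := fun k =>
    tip_int P (νM.pow_const k) (R ^ k) (Eventually.of_forall fun ω => by
      rw [abs_of_nonneg (pow_nonneg (ν0 ω).le k)]
      exact pow_le_pow_left₀ (ν0 ω).le (νR ω) k)
  have νint1 : Integrable ν P := by simpa using νint 1
  have ν'int : Integrable (fun ω => 1 / (a' ω + b' ω)) P := by
    refine tip_int P (by fun_prop) R ?_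
    filter_upwards [hX, hY] with ω hx hy
    obtain ⟨i1, -, -⟩ := tip_inc hc0 h1 h2 h3 h4 hx hy
    have hn' : a ω + b ω ≤ a' ω + b' ω := by rw [ha', hb']; linarith
    rw [abs_of_nonneg (one_div_nonneg.2 ((hnpos ω).le.trans hn'))]
    exact (one_div_le_one_div_of_le (hnpos ω) hn').trans (νR ω)
  have νYint : Integrable (fun ω => ν ω ^ 2 * Y ω) P := by
    refine (νint 2).mul_bdd (c := 1) YM.aestronglyMeasurable ?_
    filter_upwards [hY] with ω h
    rw [Real.norm_eq_abs, abs_of_nonneg h.1]; exact h.2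
  have I1 := hX2 (fun ω => ν ω ^ 2) ((νG.mono hGF le_rfl).pow_const 2) (νint 2)
  have I2 := hX1 (fun ω => ν ω ^ 2 * Y ω) (((νG.mono hGF le_rfl).pow_const 2).mul hYm) νYint
  have I3 := hY1 (fun ω => ν ω ^ 2) (νG.pow_const 2) (νint 2)
  have I4 := hY2 (fun ω => ν ω ^ 2) (νG.pow_const 2) (νint 2)
  have J1 : Integrable (fun ω => ν ω ^ 2 * (X ω * X ω)) P := by
    refine (νint 2).mul_bdd (c := 1) (hXm.mul hXm).aestronglyMeasurable ?_
    filter_upwards [hX] with ω h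
    rw [Real.norm_eq_abs, abs_of_nonneg (mul_nonneg h.1 h.1)]; nlinarith [h.1, h.2]
  have J2 : Integrable (fun ω => ν ω ^ 2 * Y ω * X ω) P := by
    refine νYint.mul_bdd (c := 1) hXm.aestronglyMeasurable ?_
    filter_upwards [hX] with ω h
    rw [Real.norm_eq_abs, abs_of_nonneg h.1]; exact h.2
  have J3 : Integrable (fun ω => ν ω ^ 2 * (Y ω * Y ω)) P := by
    refine (νint 2).mul_bdd (c := 1) (YM.mul YM).aestronglyMeasurable ?_
    filter_upwards [hY] with ω h
    rw [Real.norm_eq_abs, abs_of_nonneg (mul_nonneg h.1 h.1)]; nlinarith [h.1, h.2]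
  have mb : ∀ ω, 0 ≤ a ω / (a ω + b ω) ∧ a ω / (a ω + b ω) ≤ 1 := fun ω =>
    ⟨div_nonneg (hapos ω).le (hnpos ω).le, by rw [div_le_one (hnpos ω)]; linarith [hbpos ω]⟩
  have K1 : Integrable (fun ω => ν ω ^ 2 * (a ω / (a ω + b ω))) P := by
    refine (νint 2).mul_bdd (c := 1) (aM.div (aM.add bM)).aestronglyMeasurable ?_
    refine Eventually.of_forall fun ω => ?_
    rw [Real.norm_eq_abs, abs_of_nonneg (mb ω).1]; exact (mb ω).2
  have K2 : Integrable (fun ω => ν ω ^ 2 *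
      (a ω / (a ω + b ω) * ((a ω + 1) / (a ω + 1 + b ω)))) P := by
    refine (νint 2).mul_bdd (c := 1)
      ((aM.div (aM.add bM)).mul ((aM.add_const 1).div ((aM.add_const 1).add bM))).aestronglyMeasurable ?_
    refine Eventually.of_forall fun ω => ?_
    have q0 : 0 ≤ (a ω + 1) / (a ω + 1 + b ω) := by
      have := hapos ω; have := hbpos ω; positivity
    have q1 : (a ω + 1) / (a ω + 1 + b ω) ≤ 1 := by
      have := hapos ω; have := hbpos ω
      rw [div_le_one (by positivity)]; linarith
    rw [Real.norm_eq_abs, abs_of_nonneg (mul_nonneg (mb ω).1 q0)]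
    exact mul_le_one₀ (mb ω).2 q0 q1
  -- lower bound
  have low : (a0 * b0 / (a0 + b0 + 1)) * ∫ ω, ν ω ^ 4 ∂P ≤
      ∫ ω, ν ω ^ 2 * (X ω - Y ω) ^ 2 ∂P := by
    have eX : ∫ ω, ν ω ^ 2 * (X ω - Y ω) ^ 2 ∂P = ∫ ω, ν ω ^ 2 * (X ω * X ω) ∂P
        - 2 * ∫ ω, ν ω ^ 2 * Y ω * X ω ∂P + ∫ ω, ν ω ^ 2 * (Y ω * Y ω) ∂P := by
      have := (tip_lin J1 J2 J3 1 (-2) 1).2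
      calc _ = ∫ ω, (1 * (ν ω ^ 2 * (X ω * X ω)) + (-2) * (ν ω ^ 2 * Y ω * X ω)
            + 1 * (ν ω ^ 2 * (Y ω * Y ω))) ∂P := by
            congr 1; funext ω; ring
        _ = _ := by rw [this]; ring
    have eR : ∫ ω, ν ω ^ 2 * (X ω - Y ω) ^ 2 ∂P = ∫ ω, (μ2 * ν ω ^ 2
        + (-2 * μ1) * (ν ω ^ 2 * (a ω / (a ω + b ω)))
        + 1 * (ν ω ^ 2 * (a ω / (a ω + b ω) * ((a ω + 1) / (a ω + 1 + b ω))))) ∂P := by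
      rw [(tip_lin (νint 2) K1 K2 μ2 (-2 * μ1) 1).2, eX, I1, I2, I4,
        integral_mul_const _ (fun ω => ν ω ^ 2 * Y ω), I3, integral_mul_const]
      ring
    rw [eR, ← integral_const_mul]
    apply integral_mono ((νint 4).const_mul _) (tip_lin (νint 2) K1 K2 μ2 (-2 * μ1) 1).1
    intro ω
    have v := (tip_var ha0 hb0 (ha ω) (hb ω)).1
    simp only
    have e0 : (1 / (a ω + b ω)) = ν ω := rfl
    rw [e0] at v
    have s2 : 0 ≤ ν ω ^ 2 := sq_nonneg _
    have sq := sq_nonneg (μ1 - a ω / (a ω + b ω))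
    have : a0 * b0 / (a0 + b0 + 1) * ν ω ^ 2 ≤ μ2 - 2 * μ1 * (a ω / (a ω + b ω)) +
      (a ω / (a ω + b ω) * ((a ω + 1) / (a ω + 1 + b ω))) := by linarith
    have := mul_le_mul_of_nonneg_left this s2
    calc _ = ν ω ^ 2 * (a0 * b0 / (a0 + b0 + 1) * ν ω ^ 2) := by ring
      _ ≤ _ := this
      _ = _ := by ring
  have JXY : Integrable (fun ω => ν ω ^ 2 * (X ω - Y ω) ^ 2) P := by
    refine (tip_lin J1 J2 J3 1 (-2) 1).1.congr (Eventually.of_forall fun ω => ?_)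
    simp only; ring
  rw [mul_assoc]
  refine (mul_le_mul_of_nonneg_left low hc0.le).trans ?_
  rw [← integral_sub νint1 ν'int, ← integral_const_mul, ← integral_const_mul]
  apply integral_mono_ae (JXY.const_mul _) ((νint1.sub ν'int).const_mul _)
  filter_upwards [hX, hY] with ω hx hy
  obtain ⟨i1, i2, i3⟩ := tip_inc hc0 h1 h2 h3 h4 hx hy
  have hn' : a' ω + b' ω = (a ω + b ω) + (c * max (X ω - Y ω) 0 + e * max (Y ω - X ω) 0) := by
    rw [ha', hb']; ring
  have := tip_nu (n0 := a0 + b0) (C := C) (n := a ω + b ω) (n' := a' ω + b' ω) (by positivity)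
    (add_le_add (ha ω) (hb ω)) (by rw [hn']; linarith) (by rw [hn']; linarith)
  refine le_trans ?_ this
  have s2 : 0 ≤ ν ω ^ 2 := sq_nonneg _
  have e1 : a' ω + b' ω - (a ω + b ω) = c * max (X ω - Y ω) 0 + e * max (Y ω - X ω) 0 := by
    rw [hn']; ring
  rw [e1]
  have := mul_le_mul_of_nonneg_right i3 s2
  calc _ = c0 * (X ω - Y ω) ^ 2 * ν ω ^ 2 := by ring
    _ ≤ _ := this


theorem tip_cub {A ν Q : ℝ} (hA : 0 < A) (hQ : 0 < Q) (hν : 0 < ν) :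
    4 * Q * ν ≤ A + 4 * Q / (A / (4 * Q)) ^ 2 * ν ^ 3 := by
  have ht : 0 < A / (4 * Q) := by positivity
  rcases le_total ν (A / (4 * Q)) with h | h
  · have : 4 * Q * ν ≤ A := by rw [le_div_iff₀ (by positivity)] at h; linarith
    have : 0 ≤ 4 * Q / (A / (4 * Q)) ^ 2 * ν ^ 3 := by positivity
    linarith
  · have : 4 * Q * ν ≤ 4 * Q / (A / (4 * Q)) ^ 2 * ν ^ 3 := by
      generalize A / (4 * Q) = t at *
      rw [div_mul_eq_mul_div, le_div_iff₀ (by positivity)]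
      have : t ^ 2 ≤ ν ^ 2 := by gcongr
      have := mul_le_mul_of_nonneg_left this (show 0 ≤ 4 * Q * ν by positivity)
      linarith
    linarith

theorem tipq_meas (δ : ℝ) : Measurable (tipq δ) := by
  unfold tipq; fun_prop

theorem tip_step2 {Ω : Type*} {mG mF mΩ : MeasurableSpace Ω} (hGF : mG ≤ mF) (hF : mF ≤ mΩ)
    (P : Measure Ω) [IsProbabilityMeasure P] {c e c0 C a0 b0 μ1 μ2 κ p δ Q : ℝ}
    (X Y a b a' b' : Ω → ℝ) (hXm : Measurable X) (hYm : Measurable[mF] Y)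
    (ham : Measurable[mG] a) (hbm : Measurable[mG] b)
    (hc0 : 0 < c0) (h1 : c0 ≤ c) (h2 : c0 ≤ e) (h3 : c ≤ C) (h4 : e ≤ C)
    (ha0 : 0 < a0) (hb0 : 0 < b0) (ha : ∀ ω, a0 ≤ a ω) (hb : ∀ ω, b0 ≤ b ω)
    (ha' : ∀ ω, a' ω = a ω + c * max (X ω - Y ω) 0)
    (hb' : ∀ ω, b' ω = b ω + e * max (Y ω - X ω) 0)
    (hX : ∀ᵐ ω ∂P, 0 ≤ X ω ∧ X ω ≤ 1) (hY : ∀ᵐ ω ∂P, 0 ≤ Y ω ∧ Y ω ≤ 1)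
    (hX1 : ∀ Z : Ω → ℝ, Measurable[mF] Z → Integrable Z P →
      ∫ ω, Z ω * X ω ∂P = ∫ ω, Z ω * μ1 ∂P)
    (hX2 : ∀ Z : Ω → ℝ, Measurable[mF] Z → Integrable Z P →
      ∫ ω, Z ω * (X ω * X ω) ∂P = ∫ ω, Z ω * μ2 ∂P)
    (hY1 : ∀ Z : Ω → ℝ, Measurable[mG] Z → Integrable Z P →
      ∫ ω, Z ω * Y ω ∂P = ∫ ω, Z ω * (a ω / (a ω + b ω)) ∂P)
    (hY2 : ∀ Z : Ω → ℝ, Measurable[mG] Z → Integrable Z P →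
      ∫ ω, Z ω * (Y ω * Y ω) ∂P
        = ∫ ω, Z ω * (a ω / (a ω + b ω) * ((a ω + 1) / (a ω + 1 + b ω))) ∂P)
    (hp : 0 < p) (hp1 : p < 1) (hκ : 0 < κ) (hκ1 : κ ≤ (1 - p) * c) (hκ2 : κ ≤ p * e)
    (hδ : 0 < δ) (hQ : Q = C ^ 2 / (2 * κ * δ))
    (hs : 4 * Q * (μ2 - 2 * p * μ1 + p ^ 2) ≤ κ * δ / 2) :
    ∫ ω, tipq δ (a' ω / (a' ω + b' ω) - p) ^ 2 ∂P ≤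
      ∫ ω, tipq δ (a ω / (a ω + b ω) - p) ^ 2 ∂P
      - 2 * κ * ∫ ω, 1 / (a ω + b ω) * tipq δ (a ω / (a ω + b ω) - p) ^ 2 ∂P
      + 4 * Q / (κ * δ / 2 / (4 * Q)) ^ 2 * ∫ ω, (1 / (a ω + b ω)) ^ 4 ∂P
      + 8 * C * (1 + C / (a0 + b0)) *
        (∫ ω, 1 / (a ω + b ω) ∂P - ∫ ω, 1 / (a' ω + b' ω) ∂P) := by
  have hG := hGF.trans hF
  have hCpos : 0 < C := by linarith
  have hQ0 : 0 < Q := by rw [hQ]; positivity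
  have hapos : ∀ ω, 0 < a ω := fun ω => ha0.trans_le (ha ω)
  have hbpos : ∀ ω, 0 < b ω := fun ω => hb0.trans_le (hb ω)
  have hnpos : ∀ ω, 0 < a ω + b ω := fun ω => add_pos (hapos ω) (hbpos ω)
  have aM : Measurable a := ham.mono hG le_rfl
  have bM : Measurable b := hbm.mono hG le_rfl
  have YM : Measurable Y := hYm.mono hF le_rfl
  have a'M : Measurable a' := by
    rw [funext ha']; fun_prop
  have b'M : Measurable b' := by
    rw [funext hb']; fun_prop
  set ν : Ω → ℝ := fun ω => 1 / (a ω + b ω) with hν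
  have νG : Measurable[mG] ν := measurable_const.div (ham.add hbm)
  have νM : Measurable ν := νG.mono hG le_rfl
  have ν0 : ∀ ω, 0 < ν ω := fun ω => one_div_pos.2 (hnpos ω)
  set R := 1 / (a0 + b0) with hR
  have hR0 : 0 < R := by positivity
  have νR : ∀ ω, ν ω ≤ R := fun ω =>
    one_div_le_one_div_of_le (by positivity) (add_le_add (ha ω) (hb ω))
  have νint : ∀ k : ℕ, Integrable (fun ω => ν ω ^ k) P := fun k =>
    tip_int P (νM.pow_const k) (R ^ k) (Eventually.of_forall fun ω => by
      rw [abs_of_nonneg (pow_nonneg (ν0 ω).le k)]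
      exact pow_le_pow_left₀ (ν0 ω).le (νR ω) k)
  have νint1 : Integrable ν P := by simpa using νint 1
  have hn'pos : ∀ ω, 0 < a' ω ∧ 0 < b' ω := fun ω => by
    rw [ha', hb']
    have := hapos ω; have := hbpos ω
    have : 0 < c := by linarith
    have : 0 < e := by linarith
    constructor <;> positivity
  have ν'int : Integrable (fun ω => 1 / (a' ω + b' ω)) P := by
    refine tip_int P (by fun_prop) R ?_
    filter_upwards [hX, hY] with ω hx hy
    obtain ⟨i1, -, -⟩ := tip_inc hc0 h1 h2 h3 h4 hx hy
    have hn' : a ω + b ω ≤ a' ω + b' ω := by rw [ha', hb']; linarith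
    rw [abs_of_nonneg (one_div_nonneg.2 ((hnpos ω).le.trans hn'))]
    exact (one_div_le_one_div_of_le (hnpos ω) hn').trans (νR ω)
  set m : Ω → ℝ := fun ω => a ω / (a ω + b ω) with hmd
  have mG' : Measurable[mG] m := ham.div (ham.add hbm)
  have mM : Measurable m := mG'.mono hG le_rfl
  have mb : ∀ ω, 0 ≤ m ω ∧ m ω ≤ 1 := fun ω =>
    ⟨div_nonneg (hapos ω).le (hnpos ω).le, by
      rw [hmd]; simp only; rw [div_le_one (hnpos ω)]; linarith [hbpos ω]⟩
  have qb : ∀ x y : ℝ, 0 < x → 0 < y → |tipq δ (x / (x + y) - p)| ≤ 1 := by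
    intro x y hx hy
    refine (tipq_abs hδ _).2.1.trans ?_
    have : x / (x + y) ≤ 1 := by rw [div_le_one (by positivity)]; linarith
    have : 0 ≤ x / (x + y) := by positivity
    rw [abs_le]; constructor <;> linarith
  set q : Ω → ℝ := fun ω => tipq δ (m ω - p) with hqd
  have qG : Measurable[mG] q := (tipq_meas δ).comp (mG'.sub_const p)
  have qM : Measurable q := qG.mono hG le_rfl
  have q1 : ∀ ω, |q ω| ≤ 1 := fun ω => qb _ _ (hapos ω) (hbpos ω)
  have qsq : ∀ ω, |q ω ^ 2| ≤ 1 := fun ω => by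
    rw [abs_pow]; exact pow_le_one₀ (abs_nonneg _) (q1 ω)
  have qint : Integrable (fun ω => q ω ^ 2) P :=
    tip_int P (qM.pow_const 2) 1 (Eventually.of_forall qsq)
  have νqint : Integrable (fun ω => ν ω * q ω ^ 2) P :=
    νint1.mul_bdd (c := 1) (qM.pow_const 2).aestronglyMeasurable (Eventually.of_forall qsq)
  set W : Ω → ℝ := fun ω => ν ω * |q ω| with hW
  have WG : Measurable[mG] W := νG.mul (continuous_abs.measurable.comp qG)
  have WM : Measurable W := WG.mono hG le_rfl
  have W0 : ∀ ω, 0 ≤ W ω := fun ω => mul_nonneg (ν0 ω).le (abs_nonneg _)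
  have Wν : ∀ ω, W ω ≤ ν ω := fun ω => mul_le_of_le_one_right (ν0 ω).le (q1 ω)
  have Wint : Integrable W P := tip_int P WM R (Eventually.of_forall fun ω => by
    rw [abs_of_nonneg (W0 ω)]; exact (Wν ω).trans (νR ω))
  have bdd : ∀ Z T : Ω → ℝ, Integrable Z P → Measurable T → (∀ᵐ ω ∂P, 0 ≤ T ω ∧ T ω ≤ 1) →
      Integrable (fun ω => Z ω * T ω) P := by
    intro Z T hZ hT h
    refine hZ.mul_bdd (c := 1) hT.aestronglyMeasurable ?_
    filter_upwards [h] with ω h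
    rw [Real.norm_eq_abs, abs_of_nonneg h.1]; exact h.2
  have sqb : ∀ T : Ω → ℝ, (∀ᵐ ω ∂P, 0 ≤ T ω ∧ T ω ≤ 1) →
      ∀ᵐ ω ∂P, 0 ≤ T ω * T ω ∧ T ω * T ω ≤ 1 := by
    intro T h
    filter_upwards [h] with ω h
    exact ⟨mul_nonneg h.1 h.1, by nlinarith [h.1, h.2]⟩
  have A1 := bdd W X Wint hXm hX
  have A2 := bdd W (fun ω => X ω * X ω) Wint (hXm.mul hXm) (sqb X hX)
  have Wm := bdd W m Wint mM (Eventually.of_forall mb)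
  have A3 := bdd _ Y Wm YM hY
  have A4 := bdd W (fun ω => Y ω * Y ω) Wint (YM.mul YM) (sqb Y hY)
  have A5 := bdd W (fun ω => m ω * m ω) Wint (mM.mul mM) (sqb m (Eventually.of_forall mb))
  have A6 := bdd W _ Wint (mM.mul ((aM.add_const 1).div ((aM.add_const 1).add bM)))
    (Eventually.of_forall fun ω => by
      have := hapos ω; have := hbpos ω
      have q0 : 0 ≤ (a ω + 1) / (a ω + 1 + b ω) := by positivity
      have q1 : (a ω + 1) / (a ω + 1 + b ω) ≤ 1 := by
        rw [div_le_one (by positivity)]; linarith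
      exact ⟨mul_nonneg (mb ω).1 q0, mul_le_one₀ (mb ω).2 q0 q1⟩)
  have A7 : Integrable (fun ω => W ω * ν ω) P := by
    refine tip_int P (WM.mul νM) (R * R) (Eventually.of_forall fun ω => ?_)
    rw [abs_of_nonneg (mul_nonneg (W0 ω) (ν0 ω).le)]
    exact mul_le_mul ((Wν ω).trans (νR ω)) (νR ω) (ν0 ω).le hR0.le
  have LX := tip_lin A2 A1 Wint 1 (-2 * p) (p ^ 2)
  have LY := tip_lin A4 A3 A5 1 (-2) 1
  have eX : Integrable (fun ω => W ω * (X ω - p) ^ 2) P ∧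
      ∫ ω, W ω * (X ω - p) ^ 2 ∂P = (μ2 - 2 * p * μ1 + p ^ 2) * ∫ ω, W ω ∂P := by
    have e : (fun ω => W ω * (X ω - p) ^ 2) = fun ω => 1 * (W ω * (X ω * X ω))
        + (-2 * p) * (W ω * X ω) + p ^ 2 * W ω := by funext ω; ring
    rw [e]
    refine ⟨LX.1, ?_⟩
    rw [LX.2, hX1 W (WG.mono hGF le_rfl) Wint, hX2 W (WG.mono hGF le_rfl) Wint,
      integral_mul_const, integral_mul_const]
    ring
  have eY : Integrable (fun ω => W ω * (Y ω - m ω) ^ 2) P ∧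
      ∫ ω, W ω * (Y ω - m ω) ^ 2 ∂P ≤ ∫ ω, W ω * ν ω ∂P := by
    have e : (fun ω => W ω * (Y ω - m ω) ^ 2) = fun ω => 1 * (W ω * (Y ω * Y ω))
        + (-2) * (W ω * m ω * Y ω) + 1 * (W ω * (m ω * m ω)) := by funext ω; ring
    rw [e]
    refine ⟨LY.1, ?_⟩
    have e2 : ∫ ω, W ω * m ω * Y ω ∂P = ∫ ω, W ω * (m ω * m ω) ∂P := by
      rw [hY1 (fun ω => W ω * m ω) (WG.mul mG') Wm]
      congr 1; funext ω; ring
    rw [LY.2, hY2 W WG Wint, e2]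
    have h5 : ∫ ω, W ω * (a ω / (a ω + b ω) * ((a ω + 1) / (a ω + 1 + b ω))) ∂P
        ≤ ∫ ω, W ω * (m ω * m ω) + W ω * ν ω ∂P := by
      refine integral_mono A6 (A5.add A7) fun ω => ?_
      have v := (tip_var ha0 hb0 (ha ω) (hb ω)).2
      have v2 := mul_le_mul_of_nonneg_left v (W0 ω)
      calc W ω * (a ω / (a ω + b ω) * ((a ω + 1) / (a ω + 1 + b ω)))
          = W ω * (a ω / (a ω + b ω) * ((a ω + 1) / (a ω + 1 + b ω)) - (a ω / (a ω + b ω)) ^ 2)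
            + W ω * (m ω * m ω) := by rw [hmd]; ring
        _ ≤ W ω * ν ω + W ω * (m ω * m ω) := by linarith
        _ = _ := add_comm _ _
    rw [integral_add A5 A7] at h5
    linarith
  have L1 := tip_lin qint νqint Wint 1 (-(2 * κ)) (-(κ * δ))
  have L2 := tip_lin eX.1 eY.1 (νint1.sub ν'int) (4 * Q) (4 * Q) (8 * C * (1 + C / (a0 + b0)))
  have main : ∫ ω, tipq δ (a' ω / (a' ω + b' ω) - p) ^ 2 ∂P ≤
      ∫ ω, ((1 * q ω ^ 2 + (-(2 * κ)) * (ν ω * q ω ^ 2) + (-(κ * δ)) * W ω) +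
        (4 * Q * (W ω * (X ω - p) ^ 2) + 4 * Q * (W ω * (Y ω - m ω) ^ 2)
          + 8 * C * (1 + C / (a0 + b0)) * (ν - fun ω => 1 / (a' ω + b' ω)) ω)) ∂P := by
    refine integral_mono_ae ?_ (L1.1.add L2.1) ?_
    · refine tip_int P (((tipq_meas δ).comp (by fun_prop)).pow_const 2) 1
        (Eventually.of_forall fun ω => ?_)
      rw [abs_pow]; exact pow_le_one₀ (abs_nonneg _) (qb _ _ (hn'pos ω).1 (hn'pos ω).2)
    · filter_upwards [hX, hY] with ω hx hy
      have := tip_path (δ := δ) hp hp1 hc0 h1 h2 h3 h4 hx hy hκ hκ1 hκ2 hδ (hapos ω) (hbpos ω)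
        (show 0 < a0 + b0 by positivity) (add_le_add (ha ω) (hb ω)) (ha' ω) (hb' ω) hQ
      refine this.trans (le_of_eq ?_)
      simp only [Pi.sub_apply, hν, hW, hqd, hmd]
      ring
  rw [integral_add L1.1 L2.1, L1.2, L2.2, eX.2, integral_sub' νint1 ν'int] at main
  have last : -(κ * δ) * ∫ ω, W ω ∂P + (κ * δ / 2) * ∫ ω, W ω ∂P + 4 * Q * ∫ ω, W ω * ν ω ∂P
      ≤ 4 * Q / (κ * δ / 2 / (4 * Q)) ^ 2 * ∫ ω, ν ω ^ 4 ∂P := by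
    have L3 := tip_lin Wint Wint A7 (-(κ * δ)) (κ * δ / 2) (4 * Q)
    rw [← L3.2, ← integral_const_mul]
    refine integral_mono L3.1 ((νint 4).const_mul _) fun ω => ?_
    simp only
    have t := tip_cub (show 0 < κ * δ / 2 by positivity) hQ0 (ν0 ω)
    have t2 := mul_le_mul_of_nonneg_left t (W0 ω)
    have t3 : W ω * (4 * Q / (κ * δ / 2 / (4 * Q)) ^ 2 * ν ω ^ 3) ≤
      ν ω * (4 * Q / (κ * δ / 2 / (4 * Q)) ^ 2 * ν ω ^ 3) := by
      apply mul_le_mul_of_nonneg_right (Wν ω)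
      have := ν0 ω
      positivity
    calc _ = W ω * (4 * Q * ν ω) - W ω * (κ * δ / 2) := by ring
      _ ≤ W ω * (4 * Q / (κ * δ / 2 / (4 * Q)) ^ 2 * ν ω ^ 3) := by linarith
      _ ≤ _ := t3
      _ = _ := by ring
  have hWn : 0 ≤ ∫ ω, W ω ∂P := integral_nonneg W0
  have s1 := mul_le_mul_of_nonneg_right hs hWn
  have s2 := mul_le_mul_of_nonneg_left eY.2 (show 0 ≤ 4 * Q by positivity)
  have e4 : ∫ ω, 1 / (a ω + b ω) ∂P = ∫ ω, ν ω ∂P := rfl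
  linarith


theorem tip_real1 (v d : ℕ → ℝ) {c2 : ℝ} (hc2 : 0 < c2) (hv : ∀ j, 0 ≤ v j)
    (hst : ∀ j, c2 * d j ≤ v j - v (j + 1))
    (hd : ∀ j, ∀ l : ℝ, 0 ≤ l → 4 * l ^ 3 * v j - 3 * l ^ 4 ≤ d j) :
    Tendsto v atTop (nhds 0) := by
  have hd0 : ∀ j, 0 ≤ d j := fun j => by simpa using hd j 0 le_rfl
  have anti : Antitone v := antitone_nat_of_succ_le fun j => by
    have := mul_nonneg hc2.le (hd0 j)
    linarith [hst j]
  have bd : BddBelow (Set.range v) := ⟨0, by rintro _ ⟨j, rfl⟩; exact hv j⟩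
  have T := tendsto_atTop_ciInf anti bd
  set l := ⨅ i, v i
  have l0 : 0 ≤ l := ge_of_tendsto' T hv
  have T' : Tendsto (fun j => v (j + 1)) atTop (nhds l) := (tendsto_add_atTop_iff_nat 1).2 T
  have A : Tendsto (fun j => c2 * (4 * l ^ 3 * v j - 3 * l ^ 4)) atTop
      (nhds (c2 * (4 * l ^ 3 * l - 3 * l ^ 4))) := ((T.const_mul _).sub_const _).const_mul _
  have B : Tendsto (fun j => v j - v (j + 1)) atTop (nhds (l - l)) := T.sub T'
  have := le_of_tendsto_of_tendsto' A B fun j =>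
    (mul_le_mul_of_nonneg_left (hd j l l0) hc2.le).trans (hst j)
  have h4 : c2 * l ^ 4 ≤ 0 := by linarith
  have : l = 0 := by
    by_contra hne
    have : 0 < l := lt_of_le_of_ne l0 (Ne.symm hne)
    have : 0 < c2 * l ^ 4 := by positivity
    linarith
  rwa [this] at T

theorem tip_real2 (w v D : ℕ → ℝ) {κ Kc : ℝ} (K : ℕ) (hκ : 0 < κ) (hKc : 0 ≤ Kc)
    (hw : ∀ j, 0 ≤ w j) (hv : ∀ j, 0 ≤ v j) (hD : ∀ j, 0 ≤ D j)
    (hv0 : Tendsto v atTop (nhds 0))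
    (hst : ∀ j, K ≤ j → w (j + 1) + Kc * v (j + 1) ≤ w j + Kc * v j - κ * D j)
    (hM : ∀ l : ℝ, 0 < l → ∃ M : ℝ, 0 < M ∧ ∀ j : ℕ, (w j - l) / (M * (j + 1)) ≤ D j) :
    Tendsto w atTop (nhds 0) := by
  set g : ℕ → ℝ := fun j => w (j + K) + Kc * v (j + K) with hg
  have hstg : ∀ j, g (j + 1) ≤ g j - κ * D (j + K) := fun j => by
    have := hst (j + K) (by omega)
    simp only [hg]
    rwa [show j + 1 + K = j + K + 1 by ring]
  have g0 : ∀ j, 0 ≤ g j := fun j => add_nonneg (hw _) (mul_nonneg hKc (hv _))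
  have anti : Antitone g := antitone_nat_of_succ_le fun j => by
    have := mul_nonneg hκ.le (hD (j + K))
    linarith [hstg j]
  have bd : BddBelow (Set.range g) := ⟨0, by rintro _ ⟨j, rfl⟩; exact g0 j⟩
  have T := tendsto_atTop_ciInf anti bd
  set L := ⨅ i, g i
  have L0 : 0 ≤ L := ge_of_tendsto' T g0
  have hvK : Tendsto (fun j => v (j + K)) atTop (nhds 0) := (tendsto_add_atTop_iff_nat K).2 hv0
  have TwK : Tendsto (fun j => w (j + K)) atTop (nhds L) := by
    have := T.sub (hvK.const_mul Kc)
    simp only [mul_zero, sub_zero] at this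
    refine this.congr fun j => ?_
    simp [hg]
  rw [tendsto_add_atTop_iff_nat K] at TwK
  rcases L0.eq_or_lt with h | h
  · rwa [← h] at TwK
  exfalso
  obtain ⟨M, hM0, hM⟩ := hM (L / 2) (by positivity)
  have tele : ∀ n, κ * ∑ j ∈ Finset.range n, D (j + K) ≤ g 0 - g n := by
    intro n
    induction n with
    | zero => simp
    | succ n ih => rw [Finset.sum_range_succ]; linarith [hstg n]
  have S : Summable (fun j => D (j + K)) :=
    summable_of_sum_range_le (c := g 0 / κ) (fun j => hD _) fun n => by
      rw [le_div_iff₀ hκ]; linarith [tele n, g0 n]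
  have S' : Summable D := (summable_nat_add_iff K).1 S
  obtain ⟨N, hN⟩ := eventually_atTop.1 (TwK.eventually_const_lt (show 3 * L / 4 < L by linarith))
  have S2 : Summable (fun j => D (j + N)) := (summable_nat_add_iff N).2 S'
  have S3 : Summable (fun j : ℕ => L / 4 / M * (1 / ((j + (N + 1) : ℕ) : ℝ))) := by
    refine Summable.of_nonneg_of_le (fun j => by positivity) (fun j => ?_) S2
    refine le_trans ?_ (hM (j + N))
    rw [le_div_iff₀ (by positivity)]
    have := hN (j + N) (by omega)
    have e : L / 4 / M * (1 / ((j + (N + 1) : ℕ) : ℝ)) * (M * (((j + N : ℕ) : ℝ) + 1)) = L / 4 := by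
      push_cast
      have : (j : ℝ) + (N + 1) ≠ 0 := by positivity
      field_simp
      ring
    rw [e]; linarith
  rw [summable_mul_left_iff (by positivity)] at S3
  have := (summable_nat_add_iff (f := fun n : ℕ => 1 / (n : ℝ)) (N + 1)).1 S3
  exact Real.not_summable_one_div_natCast this

theorem tip_tail {Ω : Type*} {mΩ : MeasurableSpace Ω} (P : Measure Ω) [IsProbabilityMeasure P]
    (n : Ω → ℝ) (hn : Measurable n) (l : ℝ) (hl : 0 < l) :
    ∃ R : ℝ, 0 < R ∧ P.real {ω | R < n ω} ≤ l := by
  have T : Tendsto (fun k : ℕ => P {ω | (k : ℝ) < n ω}) atTop (nhds (P (⋂ k : ℕ, {ω | (k : ℝ) < n ω}))) := by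
    refine tendsto_measure_iInter_atTop (fun k => (measurableSet_lt measurable_const hn).nullMeasurableSet) ?_ ⟨0, measure_ne_top _ _⟩
    intro i j hij ω h
    have : (i : ℝ) ≤ j := by exact_mod_cast hij
    simp only [Set.mem_setOf_eq] at h ⊢
    linarith
  have e : (⋂ k : ℕ, {ω | (k : ℝ) < n ω}) = ∅ := by
    ext ω
    simp only [Set.mem_iInter, Set.mem_setOf_eq, Set.mem_empty_iff_false, iff_false, not_forall, not_lt]
    exact exists_nat_ge _
  rw [e, measure_empty] at T
  have := (T.eventually_lt_const (show (0 : ENNReal) < ENNReal.ofReal l by simpa using hl)).and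
    (eventually_ge_atTop 1)
  obtain ⟨k, hk, hk1⟩ := this.exists
  refine ⟨k, by exact_mod_cast hk1, ?_⟩
  exact ENNReal.toReal_le_of_le_ofReal hl.le hk.le

theorem tip_mulim {α β : ℝ} (ha : 0 < α) (hb : 0 < β) (x y : ℝ) (hx : 0 < x) (hy : 0 < y) :
    Tendsto (fun j : ℕ => (x + (j + 1 : ℕ) * α) / (x + (j + 1 : ℕ) * α + (y + (j + 1 : ℕ) * β))
      * ((x + (j + 1 : ℕ) * α + 1) / (x + (j + 1 : ℕ) * α + 1 + (y + (j + 1 : ℕ) * β)))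
      - 2 * (α / (α + β)) * ((x + (j + 1 : ℕ) * α) / (x + (j + 1 : ℕ) * α + (y + (j + 1 : ℕ) * β)))
      + (α / (α + β)) ^ 2) atTop (nhds 0) := by
  have key : ∀ u z : ℝ, Tendsto (fun k : ℕ => (u + k * α) / (z + k * (α + β))) atTop (nhds (α / (α + β))) := by
    intro u z
    have t : ∀ q : ℝ, Tendsto (fun k : ℕ => q / (k : ℝ)) atTop (nhds 0) := fun q =>
      tendsto_const_div_atTop_nhds_zero_nat q
    have := ((t u).add_const α).div ((t z).add_const (α + β)) (by positivity)
    simp only [zero_add] at this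
    refine this.congr' ?_
    filter_upwards [eventually_gt_atTop 0] with k hk
    have : (k : ℝ) ≠ 0 := by positivity
    simp only [Pi.div_apply]
    rw [← mul_div_mul_left (u / k + α) (z / k + (α + β)) this]
    congr 1 <;> field_simp
  have k1 := (tendsto_add_atTop_iff_nat 1).2 (key x (x + y))
  have k2 := (tendsto_add_atTop_iff_nat 1).2 (key (x + 1) (x + 1 + y))
  have := ((k1.mul k2).sub (k1.const_mul (2 * (α / (α + β))))).add_const ((α / (α + β)) ^ 2)
  rw [show α / (α + β) * (α / (α + β)) - 2 * (α / (α + β)) * (α / (α + β)) + (α / (α + β)) ^ 2 = 0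
    by ring] at this
  refine this.congr fun j => ?_
  have e1 : x + (j + 1 : ℕ) * α + (y + (j + 1 : ℕ) * β) = x + y + (j + 1 : ℕ) * (α + β) := by ring
  have e2 : x + (j + 1 : ℕ) * α + 1 + (y + (j + 1 : ℕ) * β) = x + 1 + y + (j + 1 : ℕ) * (α + β) := by ring
  have e3 : x + 1 + (j + 1 : ℕ) * α = x + (j + 1 : ℕ) * α + 1 := by ring
  rw [e1, e2, e3]


theorem tip_core {Ω : Type*} {mΩ : MeasurableSpace Ω} (G F : ℕ → MeasurableSpace Ω)
    (hGF : ∀ j, G j ≤ F j) (hF : ∀ j, F j ≤ mΩ)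
    (P : Measure Ω) [IsProbabilityMeasure P] {c e a0 b0 p : ℝ} (μ1 μ2 : ℕ → ℝ)
    (X Y a b : ℕ → Ω → ℝ) (hXm : ∀ j, Measurable (X j)) (hYm : ∀ j, Measurable[F j] (Y j))
    (ham : ∀ j, Measurable[G j] (a j)) (hbm : ∀ j, Measurable[G j] (b j))
    (hc : 0 < c) (he : 0 < e)
    (ha0 : 0 < a0) (hb0 : 0 < b0) (ha : ∀ j ω, a0 ≤ a j ω) (hb : ∀ j ω, b0 ≤ b j ω)
    (ha' : ∀ j ω, a (j + 1) ω = a j ω + c * max (X (j + 1) ω - Y j ω) 0)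
    (hb' : ∀ j ω, b (j + 1) ω = b j ω + e * max (Y j ω - X (j + 1) ω) 0)
    (hX : ∀ j, ∀ᵐ ω ∂P, 0 ≤ X j ω ∧ X j ω ≤ 1) (hY : ∀ j, ∀ᵐ ω ∂P, 0 ≤ Y j ω ∧ Y j ω ≤ 1)
    (hμ : ∀ j, μ1 j ^ 2 ≤ μ2 j)
    (hX1 : ∀ j, ∀ Z : Ω → ℝ, Measurable[F j] Z → Integrable Z P →
      ∫ ω, Z ω * X (j + 1) ω ∂P = ∫ ω, Z ω * μ1 (j + 1) ∂P)
    (hX2 : ∀ j, ∀ Z : Ω → ℝ, Measurable[F j] Z → Integrable Z P →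
      ∫ ω, Z ω * (X (j + 1) ω * X (j + 1) ω) ∂P = ∫ ω, Z ω * μ2 (j + 1) ∂P)
    (hY1 : ∀ j, ∀ Z : Ω → ℝ, Measurable[G j] Z → Integrable Z P →
      ∫ ω, Z ω * Y j ω ∂P = ∫ ω, Z ω * (a j ω / (a j ω + b j ω)) ∂P)
    (hY2 : ∀ j, ∀ Z : Ω → ℝ, Measurable[G j] Z → Integrable Z P →
      ∫ ω, Z ω * (Y j ω * Y j ω) ∂P
        = ∫ ω, Z ω * (a j ω / (a j ω + b j ω) * ((a j ω + 1) / (a j ω + 1 + b j ω))) ∂P)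
    (hp : 0 < p) (hp1 : p < 1)
    (hs : Tendsto (fun j => μ2 j - 2 * p * μ1 j + p ^ 2) atTop (nhds 0)) :
    Tendsto (fun j => ∫ ω, (X j ω - Y j ω) ^ 2 ∂P) atTop (nhds 0) := by
  obtain ⟨c0, hc0, h1, h2⟩ : ∃ c0, 0 < c0 ∧ c0 ≤ c ∧ c0 ≤ e :=
    ⟨min c e, lt_min hc he, min_le_left _ _, min_le_right _ _⟩
  obtain ⟨C, h3, h4⟩ : ∃ C, c ≤ C ∧ e ≤ C := ⟨max c e, le_max_left _ _, le_max_right _ _⟩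
  obtain ⟨κ, hκ, hκ1, hκ2⟩ : ∃ κ, 0 < κ ∧ κ ≤ (1 - p) * c ∧ κ ≤ p * e :=
    ⟨min ((1 - p) * c) (p * e), lt_min (mul_pos (by linarith) hc) (mul_pos hp he),
      min_le_left _ _, min_le_right _ _⟩
  have hC : 0 < C := by linarith
  have hG : ∀ j, G j ≤ mΩ := fun j => (hGF j).trans (hF j)
  have aM : ∀ j, Measurable (a j) := fun j => (ham j).mono (hG j) le_rfl
  have bM : ∀ j, Measurable (b j) := fun j => (hbm j).mono (hG j) le_rfl
  have YM : ∀ j, Measurable (Y j) := fun j => (hYm j).mono (hF j) le_rfl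
  have ap : ∀ j ω, 0 < a j ω := fun j ω => ha0.trans_le (ha j ω)
  have bp : ∀ j ω, 0 < b j ω := fun j ω => hb0.trans_le (hb j ω)
  have np : ∀ j ω, 0 < a j ω + b j ω := fun j ω => add_pos (ap j ω) (bp j ω)
  have ν0 : ∀ j ω, 0 < 1 / (a j ω + b j ω) := fun j ω => one_div_pos.2 (np j ω)
  have νR : ∀ j ω, 1 / (a j ω + b j ω) ≤ 1 / (a0 + b0) := fun j ω =>
    one_div_le_one_div_of_le (by positivity) (add_le_add (ha j ω) (hb j ω))
  have νM : ∀ j, Measurable fun ω => 1 / (a j ω + b j ω) := fun j =>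
    measurable_const.div ((aM j).add (bM j))
  have νI : ∀ j, Integrable (fun ω => 1 / (a j ω + b j ω)) P := fun j =>
    tip_int P (νM j) _ (Eventually.of_forall fun ω => by
      rw [abs_of_pos (ν0 j ω)]; exact νR j ω)
  have ν4I : ∀ j, Integrable (fun ω => (1 / (a j ω + b j ω)) ^ 4) P := fun j =>
    tip_int P ((νM j).pow_const 4) ((1 / (a0 + b0)) ^ 4) (Eventually.of_forall fun ω => by
      rw [abs_of_pos (pow_pos (ν0 j ω) 4)]; exact pow_le_pow_left₀ (ν0 j ω).le (νR j ω) 4)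
  set v : ℕ → ℝ := fun j => ∫ ω, 1 / (a j ω + b j ω) ∂P with hvd
  set d : ℕ → ℝ := fun j => ∫ ω, (1 / (a j ω + b j ω)) ^ 4 ∂P with hdd
  have v0 : ∀ j, 0 ≤ v j := fun j => integral_nonneg fun ω => (ν0 j ω).le
  have S1 : ∀ j, c0 * (a0 * b0 / (a0 + b0 + 1)) * d j ≤
      (1 + C / (a0 + b0)) * (v j - v (j + 1)) := fun j =>
    tip_step1 (hGF j) (hF j) P (X (j + 1)) (Y j) (a j) (b j) (a (j + 1)) (b (j + 1))
      (hXm _) (hYm j) (ham j) (hbm j) hc0 h1 h2 h3 h4 ha0 hb0 (ha j) (hb j) (ha' j) (hb' j)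
      (hX _) (hY j) (hμ (j + 1)) (hX1 j) (hX2 j) (hY1 j) (hY2 j)
  set A := c0 * (a0 * b0 / (a0 + b0 + 1)) with hA
  set B := 1 + C / (a0 + b0) with hB
  have A0 : 0 < A := by positivity
  have B0 : 0 < B := by positivity
  have vT : Tendsto v atTop (nhds 0) := by
    refine tip_real1 v d (div_pos A0 B0) v0 (fun j => ?_) fun j l hl => ?_
    · rw [div_mul_eq_mul_div, div_le_iff₀ B0]; linarith [S1 j]
    · have e1 : 4 * l ^ 3 * v j - 3 * l ^ 4
          = ∫ ω, (4 * l ^ 3 * (1 / (a j ω + b j ω)) - 3 * l ^ 4) ∂P := by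
        rw [integral_sub ((νI j).const_mul _) (integrable_const _), integral_const_mul]
        simp [hvd]
      rw [e1]
      refine integral_mono (((νI j).const_mul _).sub (integrable_const _)) (ν4I j) fun ω => ?_
      simp only
      generalize 1 / (a j ω + b j ω) = t
      nlinarith [mul_nonneg (sq_nonneg (t - l)) (add_nonneg (sq_nonneg (t + l)) (mul_nonneg (by norm_num : (0:ℝ) ≤ 2) (sq_nonneg l)))]
  -- the total count grows at most linearly
  have grow : ∀ᵐ ω ∂P, ∀ j : ℕ, a j ω + b j ω ≤ a 0 ω + b 0 ω + C * j := by
    filter_upwards [ae_all_iff.2 hX, ae_all_iff.2 hY] with ω hx hy j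
    induction j with
    | zero => simp
    | succ j ih =>
      have := (tip_inc hc0 h1 h2 h3 h4 (hx (j + 1)) (hy j)).2.1
      rw [ha', hb']; push_cast; linarith
  set m : ℕ → Ω → ℝ := fun j ω => a j ω / (a j ω + b j ω) with hmd
  have mG : ∀ j, Measurable[G j] (m j) := fun j => (ham j).div ((ham j).add (hbm j))
  have mM : ∀ j, Measurable (m j) := fun j => (mG j).mono (hG j) le_rfl
  have mb : ∀ j ω, 0 ≤ m j ω ∧ m j ω ≤ 1 := fun j ω =>
    ⟨div_nonneg (ap j ω).le (np j ω).le, by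
      rw [hmd]; simp only; rw [div_le_one (np j ω)]; linarith [bp j ω]⟩
  have wT : ∀ δ : ℝ, 0 < δ →
      Tendsto (fun j => ∫ ω, tipq δ (m j ω - p) ^ 2 ∂P) atTop (nhds 0) := by
    intro δ hδ
    have q1 : ∀ j ω, |tipq δ (m j ω - p)| ≤ 1 := fun j ω => by
      refine (tipq_abs hδ _).2.1.trans ?_
      have := mb j ω
      rw [abs_le]; constructor <;> linarith
    have q2 : ∀ j ω, tipq δ (m j ω - p) ^ 2 ≤ 1 := fun j ω => by
      rw [← sq_abs]; exact pow_le_one₀ (abs_nonneg _) (q1 j ω)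
    have qM : ∀ j, Measurable fun ω => tipq δ (m j ω - p) ^ 2 := fun j =>
      ((tipq_meas δ).comp ((mM j).sub_const p)).pow_const 2
    have qI : ∀ j, Integrable (fun ω => tipq δ (m j ω - p) ^ 2) P := fun j =>
      tip_int P (qM j) 1 (Eventually.of_forall fun ω => by
        rw [abs_of_nonneg (sq_nonneg _)]; exact q2 j ω)
    have νqI : ∀ j, Integrable (fun ω => 1 / (a j ω + b j ω) * tipq δ (m j ω - p) ^ 2) P := fun j =>
      (νI j).mul_bdd (c := 1) (qM j).aestronglyMeasurable (Eventually.of_forall fun ω => by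
        rw [Real.norm_eq_abs, abs_of_nonneg (sq_nonneg _)]; exact q2 j ω)
    set Q := C ^ 2 / (2 * κ * δ) with hQ
    have hQ0 : 0 < Q := by positivity
    have ev : ∀ᶠ j in atTop, 4 * Q * (μ2 j - 2 * p * μ1 j + p ^ 2) ≤ κ * δ / 2 := by
      have := hs.const_mul (4 * Q)
      rw [mul_zero] at this
      exact this.eventually_le_const (by positivity)
    obtain ⟨K, hK⟩ := eventually_atTop.1 ev
    set E := 4 * Q / (κ * δ / 2 / (4 * Q)) ^ 2 with hE
    have E0 : 0 < E := by positivity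
    refine tip_real2 _ v (fun j => ∫ ω, 1 / (a j ω + b j ω) * tipq δ (m j ω - p) ^ 2 ∂P)
      (κ := 2 * κ) (Kc := E * (B / A) + 8 * C * B) K (by positivity) (by positivity)
      (fun j => integral_nonneg fun ω => sq_nonneg _) v0
      (fun j => integral_nonneg fun ω => mul_nonneg (ν0 j ω).le (sq_nonneg _)) vT ?_ ?_
    · intro j hj
      have S2 := tip_step2 (hGF j) (hF j) P (X (j + 1)) (Y j) (a j) (b j) (a (j + 1)) (b (j + 1))
        (hXm _) (hYm j) (ham j) (hbm j) hc0 h1 h2 h3 h4 ha0 hb0 (ha j) (hb j) (ha' j) (hb' j)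
        (hX _) (hY j) (hX1 j) (hX2 j) (hY1 j) (hY2 j) hp hp1 hκ hκ1 hκ2 hδ hQ
        (hK (j + 1) (by omega))
      have S3 : E * d j ≤ E * (B / A) * (v j - v (j + 1)) := by
        rw [mul_assoc]
        refine mul_le_mul_of_nonneg_left ?_ E0.le
        rw [div_mul_eq_mul_div, le_div_iff₀ A0]; linarith [S1 j]
      rw [← hE, ← hB] at S2
      simp only [hmd]
      simp only [hdd, hvd] at S3
      simp only [hvd]
      linarith
    · intro l hl
      obtain ⟨R, hR0, hR⟩ := tip_tail P (fun ω => a 0 ω + b 0 ω) ((aM 0).add (bM 0)) l hl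
      refine ⟨R + C, by positivity, fun j => ?_⟩
      have hS : MeasurableSet {ω | R < a 0 ω + b 0 ω} :=
        measurableSet_lt measurable_const ((aM 0).add (bM 0))
      have iI : Integrable ({ω | R < a 0 ω + b 0 ω}.indicator fun _ => (1 : ℝ)) P :=
        (integrable_const 1).indicator hS
      have e1 : ∫ ω, {ω | R < a 0 ω + b 0 ω}.indicator (fun _ => (1 : ℝ)) ω ∂P
          = P.real {ω | R < a 0 ω + b 0 ω} := integral_indicator_one hS
      calc (∫ ω, tipq δ (m j ω - p) ^ 2 ∂P - l) / ((R + C) * (j + 1))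
          ≤ (∫ ω, tipq δ (m j ω - p) ^ 2 ∂P
            - ∫ ω, {ω | R < a 0 ω + b 0 ω}.indicator (fun _ => (1 : ℝ)) ω ∂P)
              / ((R + C) * (j + 1)) := by
            rw [e1]; gcongr
        _ = ∫ ω, (tipq δ (m j ω - p) ^ 2 - {ω | R < a 0 ω + b 0 ω}.indicator (fun _ => (1 : ℝ)) ω)
              / ((R + C) * (j + 1)) ∂P := by
            rw [integral_div, integral_sub (qI j) iI]
        _ ≤ _ := by
          refine integral_mono_ae (((qI j).sub iI).div_const _) (νqI j) ?_
          filter_upwards [grow] with ω hg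
          have hgj := hg j
          by_cases hω : R < a 0 ω + b 0 ω
          · rw [Set.indicator_of_mem (by exact hω)]
            refine le_trans (div_nonpos_of_nonpos_of_nonneg ?_ (by positivity))
              (mul_nonneg (ν0 j ω).le (sq_nonneg _))
            linarith [q2 j ω]
          · rw [Set.indicator_of_notMem (by exact hω), sub_zero, one_div_mul_eq_div]
            refine div_le_div_of_nonneg_left (sq_nonneg _) (np j ω) ?_
            push Not at hω
            have : (0 : ℝ) ≤ j := Nat.cast_nonneg j
            nlinarith [mul_nonneg hR0.le this]
  have bI : ∀ f : Ω → ℝ, Measurable f → (∀ᵐ ω ∂P, |f ω| ≤ 1) → Integrable (fun ω => f ω ^ 2) P := by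
    intro f hf h
    refine tip_int P (hf.pow_const 2) 1 ?_
    filter_upwards [h] with ω h
    rw [abs_pow]; exact pow_le_one₀ (abs_nonneg _) h
  have uI : ∀ j, Integrable (fun ω => (m j ω - p) ^ 2) P := fun j =>
    bI _ ((mM j).sub_const p) (Eventually.of_forall fun ω => by
      have := mb j ω
      rw [abs_le]; constructor <;> linarith)
  have uT : Tendsto (fun j => ∫ ω, (m j ω - p) ^ 2 ∂P) atTop (nhds 0) := by
    rw [Metric.tendsto_atTop]
    intro η hη
    obtain ⟨δ, hδ, hδη⟩ : ∃ δ : ℝ, 0 < δ ∧ 2 * δ ^ 2 ≤ η / 2 := by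
      refine ⟨Real.sqrt (η / 4), by positivity, ?_⟩
      rw [Real.sq_sqrt (by positivity)]; linarith
    obtain ⟨N, hN⟩ := eventually_atTop.1
      ((wT δ hδ).eventually_lt_const (show (0:ℝ) < η / 4 by positivity))
    refine ⟨N, fun j hj => ?_⟩
    rw [Real.dist_eq, sub_zero, abs_of_nonneg (integral_nonneg fun ω => sq_nonneg _)]
    have qI : Integrable (fun ω => tipq δ (m j ω - p) ^ 2) P :=
      bI _ ((tipq_meas δ).comp ((mM j).sub_const p)) (Eventually.of_forall fun ω => by
        refine (tipq_abs hδ _).2.1.trans ?_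
        have := mb j ω
        rw [abs_le]; constructor <;> linarith)
    have : ∫ ω, (m j ω - p) ^ 2 ∂P ≤ ∫ ω, (2 * tipq δ (m j ω - p) ^ 2 + 2 * δ ^ 2) ∂P :=
      integral_mono (uI j) ((qI.const_mul 2).add (integrable_const _)) fun ω =>
        (tipq_abs hδ _).2.2.2.2
    rw [integral_add (qI.const_mul 2) (integrable_const _), integral_const_mul] at this
    simp only [integral_const, probReal_univ, smul_eq_mul, one_mul] at this
    linarith [hN j hj]
  have bdd : ∀ Z T : Ω → ℝ, Integrable Z P → Measurable T → (∀ᵐ ω ∂P, 0 ≤ T ω ∧ T ω ≤ 1) →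
      Integrable (fun ω => Z ω * T ω) P := by
    intro Z T hZ hT h
    refine hZ.mul_bdd (c := 1) hT.aestronglyMeasurable ?_
    filter_upwards [h] with ω h
    rw [Real.norm_eq_abs, abs_of_nonneg h.1]; exact h.2
  have oneb : ∀ T : Ω → ℝ, Measurable T → (∀ᵐ ω ∂P, 0 ≤ T ω ∧ T ω ≤ 1) → Integrable T P := by
    intro T hT h
    simpa using bdd (fun _ => 1) T (integrable_const _) hT h
  have sqb : ∀ T : Ω → ℝ, (∀ᵐ ω ∂P, 0 ≤ T ω ∧ T ω ≤ 1) →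
      ∀ᵐ ω ∂P, 0 ≤ T ω * T ω ∧ T ω * T ω ≤ 1 := by
    intro T h
    filter_upwards [h] with ω h
    exact ⟨mul_nonneg h.1 h.1, by nlinarith [h.1, h.2]⟩
  have mI : ∀ j, Integrable (m j) P := fun j => oneb _ (mM j) (Eventually.of_forall (mb j))
  have yI : ∀ j, Integrable (fun ω => (Y j ω - m j ω) ^ 2) P := fun j =>
    bI _ ((YM j).sub (mM j)) (by
      filter_upwards [hY j] with ω h
      have := mb j ω
      rw [abs_le]; constructor <;> linarith)
  have yv : ∀ j, ∫ ω, (Y j ω - m j ω) ^ 2 ∂P ≤ v j := by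
    intro j
    have i1 : Integrable (fun ω => Y j ω * Y j ω) P := oneb _ ((YM j).mul (YM j)) (sqb _ (hY j))
    have i2 := bdd _ (Y j) (mI j) (YM j) (hY j)
    have i3 := bdd _ (m j) (mI j) (mM j) (Eventually.of_forall (mb j))
    have L := tip_lin i1 i2 i3 1 (-2) 1
    have ee : (fun ω => (Y j ω - m j ω) ^ 2) = fun ω => 1 * (Y j ω * Y j ω)
        + (-2) * (m j ω * Y j ω) + 1 * (m j ω * m j ω) := by funext ω; ring
    have f1 := hY2 j (fun _ => 1) measurable_const (integrable_const _)
    have f2 := hY1 j (m j) (mG j) (mI j)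
    simp only [one_mul] at f1
    have i4 : Integrable (fun ω => a j ω / (a j ω + b j ω) * ((a j ω + 1) / (a j ω + 1 + b j ω))) P := by
      refine bdd _ _ (mI j) (((aM j).add_const 1).div (((aM j).add_const 1).add (bM j)))
        (Eventually.of_forall fun ω => ?_)
      have := ap j ω; have := bp j ω
      exact ⟨by positivity, by rw [div_le_one (by positivity)]; linarith⟩
    have f3 : ∫ ω, a j ω / (a j ω + b j ω) * ((a j ω + 1) / (a j ω + 1 + b j ω)) ∂P
        ≤ ∫ ω, (1 / (a j ω + b j ω) + m j ω * m j ω) ∂P :=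
      integral_mono i4 ((νI j).add i3) fun ω => by
        have := (tip_var ha0 hb0 (ha j ω) (hb j ω)).2
        simp only [hmd]
        linarith
    rw [integral_add (νI j) i3] at f3
    have f4 : ∫ ω, m j ω * (a j ω / (a j ω + b j ω)) ∂P = ∫ ω, m j ω * m j ω ∂P := rfl
    have f5 : v j = ∫ ω, 1 / (a j ω + b j ω) ∂P := rfl
    rw [ee, L.2, f2, f1, f4, f5]
    linarith
  have xI : ∀ j, Integrable (fun ω => (X j ω - p) ^ 2) P := fun j =>
    bI _ ((hXm j).sub_const p) (by
      filter_upwards [hX j] with ω h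
      rw [abs_le]; constructor <;> linarith)
  have xs : ∀ j, ∫ ω, (X (j + 1) ω - p) ^ 2 ∂P = μ2 (j + 1) - 2 * p * μ1 (j + 1) + p ^ 2 := by
    intro j
    have i1 : Integrable (fun ω => X (j + 1) ω * X (j + 1) ω) P := oneb _ ((hXm (j + 1)).mul (hXm (j + 1))) (sqb _ (hX (j + 1)))
    have i2 := oneb _ (hXm (j + 1)) (hX (j + 1))
    have L := tip_lin i1 i2 (integrable_const (μ := P) (1:ℝ)) 1 (-2 * p) (p ^ 2)
    have ee : (fun ω => (X (j + 1) ω - p) ^ 2) = fun ω => 1 * (X (j + 1) ω * X (j + 1) ω)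
        + (-2 * p) * X (j + 1) ω + p ^ 2 * 1 := by funext ω; ring
    have f1 := hX2 j (fun _ => 1) measurable_const (integrable_const _)
    have f2 := hX1 j (fun _ => 1) measurable_const (integrable_const _)
    simp only [one_mul, integral_const, probReal_univ, smul_eq_mul] at f1 f2
    rw [ee, L.2]
    rw [f1, f2]
    simp; ring
  rw [← tendsto_add_atTop_iff_nat 1]
  have hub := (((tendsto_add_atTop_iff_nat 1).2 hs).add
    (((tendsto_add_atTop_iff_nat 1).2 uT).add ((tendsto_add_atTop_iff_nat 1).2 vT))).const_mul 3
  simp only [add_zero, mul_zero] at hub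
  refine squeeze_zero (fun j => integral_nonneg fun ω => sq_nonneg _) (fun j => ?_) hub
  have L := tip_lin (xI (j + 1)) (uI (j + 1)) (yI (j + 1)) 3 3 3
  have : ∫ ω, (X (j + 1) ω - Y (j + 1) ω) ^ 2 ∂P ≤
      ∫ ω, (3 * (X (j + 1) ω - p) ^ 2 + 3 * (m (j + 1) ω - p) ^ 2
        + 3 * (Y (j + 1) ω - m (j + 1) ω) ^ 2) ∂P := by
    refine integral_mono_ae (bI _ ((hXm _).sub (YM _)) ?_) L.1 (Eventually.of_forall fun ω => ?_)
    · filter_upwards [hX (j + 1), hY (j + 1)] with ω h h'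
      rw [abs_le]; constructor <;> linarith
    · simp only
      generalize X (j + 1) ω = x
      generalize Y (j + 1) ω = y
      generalize m (j + 1) ω = z
      nlinarith [sq_nonneg ((x - p) + (z - p)), sq_nonneg ((z - p) - (y - z)), sq_nonneg ((x - p) + (y - z))]
  rw [L.2, xs] at this
  linarith [yv (j + 1)]


/-- **TIP model with `n = 0`: the indirect follower's trust tracks the direct agent's
trust.** Agent `x` updates trust in the robot only through direct experience, with
`Tx k ∼ Beta(αx₀ + k·s·r, βx₀ + k·f·(1−r))` conditionally on the past; agent `y` updates
only through indirect experience, comparing `x`'s communicated trust sample `Tx k` with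
`y`'s previous trust sample `Ty (k−1)`, discounted by the interpersonal trust `txy`.
Then `Tx k − Ty k → 0` in probability. -/
theorem tip_indirect_only_trust_difference_converges
    {Ω : Type*} [MeasurableSpace Ω] (P : Measure Ω) [IsProbabilityMeasure P]
    (ℱ : Filtration ℕ ‹MeasurableSpace Ω›)
    (r s f sh fh : ℝ) (hr : r ∈ Set.Ioo (0 : ℝ) 1)
    (hs : 0 < s) (hf : 0 < f) (hsh : 0 < sh) (hfh : 0 < fh)
    (txy : ℝ) (htxy : txy ∈ Set.Ioc (0 : ℝ) 1)
    (ax0 bx0 ay0 by0 : ℝ) (hax0 : 0 < ax0) (hbx0 : 0 < bx0) (hay0 : 0 < ay0) (hby0 : 0 < by0)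
    (Tx Ty : ℕ → Ω → ℝ) (ay bY : ℕ → Ω → ℝ)
    (hTx_adapted : Adapted ℱ Tx) (hTy_adapted : Adapted ℱ Ty)
    (hay_adapted : Adapted ℱ ay) (hbY_adapted : Adapted ℱ bY)
    (hay_init : ∀ ω, ay 0 ω = ay0) (hbY_init : ∀ ω, bY 0 ω = by0)
    -- the conditional law of `Tx k` given `ℱ (k−1)` is Beta(ax0 + k·s·r, bx0 + k·f·(1−r))
    (hTx_condLaw : ∀ k, 1 ≤ k → ∀ A : Set ℝ, MeasurableSet A →
      P[fun ω => A.indicator (fun _ => (1 : ℝ)) (Tx k ω) | ℱ (k - 1)]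
        =ᵐ[P] fun _ =>
          (betaMeasure (ax0 + k * s * r) (bx0 + k * f * (1 - r)) A).toReal)
    -- `y`'s indirect experience updates
    (hay_update : ∀ k, 1 ≤ k → ∀ ω,
      ay k ω = ay (k - 1) ω + sh * txy * max (Tx k ω - Ty (k - 1) ω) 0)
    (hbY_update : ∀ k, 1 ≤ k → ∀ ω,
      bY k ω = bY (k - 1) ω + fh * txy * max (Ty (k - 1) ω - Tx k ω) 0)
    -- the conditional law of `Ty k` given `ℱ (k−1)` and `Tx k` is Beta(ay k, bY k)
    (hTy_condLaw : ∀ k, 1 ≤ k → ∀ A : Set ℝ, MeasurableSet A →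
      P[fun ω => A.indicator (fun _ => (1 : ℝ)) (Ty k ω)
          | (ℱ (k - 1) : MeasurableSpace Ω) ⊔ MeasurableSpace.comap (Tx k) inferInstance]
        =ᵐ[P] fun ω => (betaMeasure (ay k ω) (bY k ω) A).toReal) :
    ∀ ε > 0, Tendsto (fun k => P {ω | ε < |Tx k ω - Ty k ω|}) atTop (nhds 0) := by
  intro ε hε
  obtain ⟨hr0, hr1⟩ := hr
  have hc : 0 < sh * txy := mul_pos hsh htxy.1
  have he : 0 < fh * txy := mul_pos hfh htxy.1
  have hα : 0 < s * r := mul_pos hs hr0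
  have hβ : 0 < f * (1 - r) := mul_pos hf (by linarith)
  have hayL : ∀ k ω, ay0 ≤ ay k ω := by
    intro k ω
    induction k with
    | zero => rw [hay_init]
    | succ k ih =>
      rw [hay_update (k + 1) (by omega)]
      have : 0 ≤ sh * txy * max (Tx (k + 1) ω - Ty (k + 1 - 1) ω) 0 :=
        mul_nonneg hc.le (le_max_right _ _)
      simp only [Nat.add_sub_cancel] at *
      linarith
  have hbyL : ∀ k ω, by0 ≤ bY k ω := by
    intro k ω
    induction k with
    | zero => rw [hbY_init]
    | succ k ih =>
      rw [hbY_update (k + 1) (by omega)]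
      have : 0 ≤ fh * txy * max (Ty (k + 1 - 1) ω - Tx (k + 1) ω) 0 :=
        mul_nonneg he.le (le_max_right _ _)
      simp only [Nat.add_sub_cancel] at *
      linarith
  have TxM : ∀ k, Measurable (Tx k) := fun k => (hTx_adapted k).mono (ℱ.le k) le_rfl
  have TyM : ∀ k, Measurable (Ty k) := fun k => (hTy_adapted k).mono (ℱ.le k) le_rfl
  let G : ℕ → MeasurableSpace Ω := fun j =>
    (ℱ j : MeasurableSpace Ω) ⊔ MeasurableSpace.comap (Tx (j + 1)) inferInstance
  have hGF : ∀ j, G j ≤ ℱ (j + 1) := fun j =>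
    sup_le (ℱ.mono (Nat.le_succ j)) (hTx_adapted (j + 1)).comap_le
  have TxG : ∀ j, Measurable[G j] (Tx (j + 1)) := fun j =>
    Measurable.mono (comap_measurable (Tx (j + 1))) le_sup_right le_rfl
  have TyG : ∀ j, Measurable[G j] (Ty j) := fun j => (hTy_adapted j).mono le_sup_left le_rfl
  have ayG : ∀ j, Measurable[G j] (ay (j + 1)) := fun j => by
    have e : ay (j + 1) = fun ω => ay j ω + sh * txy * max (Tx (j + 1) ω - Ty j ω) 0 :=
      funext fun ω => hay_update (j + 1) (by omega) ω
    rw [e]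
    exact ((hay_adapted j).mono le_sup_left le_rfl).add
      ((((TxG j).sub (TyG j)).max measurable_const).const_mul _)
  have byG : ∀ j, Measurable[G j] (bY (j + 1)) := fun j => by
    have e : bY (j + 1) = fun ω => bY j ω + fh * txy * max (Ty j ω - Tx (j + 1) ω) 0 :=
      funext fun ω => hbY_update (j + 1) (by omega) ω
    rw [e]
    exact ((hbY_adapted j).mono le_sup_left le_rfl).add
      ((((TyG j).sub (TxG j)).max measurable_const).const_mul _)
  have ca : ∀ j : ℕ, 0 < ax0 + ((j + 1 : ℕ) : ℝ) * (s * r) := fun j => by positivity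
  have cb : ∀ j : ℕ, 0 < bx0 + ((j + 1 : ℕ) : ℝ) * (f * (1 - r)) := fun j => by positivity
  have MX := fun j => tip_mom (ℱ.le j) P (Tx (j + 1)) (TxM _)
    (fun _ => ax0 + ((j + 1 : ℕ) : ℝ) * (s * r)) (fun _ => bx0 + ((j + 1 : ℕ) : ℝ) * (f * (1 - r)))
    measurable_const measurable_const (fun _ => ca j) (fun _ => cb j)
    (fun A hA => by
      have := hTx_condLaw (j + 1) (by omega) A hA
      simpa only [← mul_assoc, Nat.add_sub_cancel] using this)
  have MY := fun j => tip_mom ((hGF j).trans (ℱ.le _)) P (Ty (j + 1)) (TyM _) (ay (j + 1))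
    (bY (j + 1)) (ayG j) (byG j) (fun ω => hay0.trans_le (hayL _ ω))
    (fun ω => hby0.trans_le (hbyL _ ω))
    (fun A hA => hTy_condLaw (j + 1) (by omega) A hA)
  have core := tip_core G (fun j => ℱ (j + 1)) hGF (fun j => ℱ.le _) P
    (p := s * r / (s * r + f * (1 - r)))
    (fun j => (ax0 + ((j + 1 : ℕ) : ℝ) * (s * r)) /
      (ax0 + ((j + 1 : ℕ) : ℝ) * (s * r) + (bx0 + ((j + 1 : ℕ) : ℝ) * (f * (1 - r)))))
    (fun j => (ax0 + ((j + 1 : ℕ) : ℝ) * (s * r)) /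
      (ax0 + ((j + 1 : ℕ) : ℝ) * (s * r) + (bx0 + ((j + 1 : ℕ) : ℝ) * (f * (1 - r)))) *
      ((ax0 + ((j + 1 : ℕ) : ℝ) * (s * r) + 1) /
      (ax0 + ((j + 1 : ℕ) : ℝ) * (s * r) + 1 + (bx0 + ((j + 1 : ℕ) : ℝ) * (f * (1 - r))))))
    (fun j => Tx (j + 1)) (fun j => Ty (j + 1)) (fun j => ay (j + 1)) (fun j => bY (j + 1))
    (fun j => TxM _) (fun j => hTy_adapted _) ayG byG hc he hay0 hby0
    (fun j => hayL _) (fun j => hbyL _)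
    (fun j ω => hay_update (j + 1 + 1) (by omega) ω)
    (fun j ω => hbY_update (j + 1 + 1) (by omega) ω)
    (fun j => (MX j).1) (fun j => (MY j).1)
    (fun j => by
      have h := (tip_var (ca j) (cb j) le_rfl le_rfl).1
      have := ca j
      have := cb j
      refine sub_nonneg.1 (le_trans ?_ h)
      positivity)
    (fun j => (MX (j + 1)).2.1) (fun j => (MX (j + 1)).2.2)
    (fun j => (MY j).2.1) (fun j => (MY j).2.2)
    (by positivity) (by rw [div_lt_one (by positivity)]; linarith)
    (tip_mulim hα hβ ax0 bx0 hax0 hbx0)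
  rw [← tendsto_add_atTop_iff_nat 1]
  have lim : Tendsto (fun j => ENNReal.ofReal
      ((∫ ω, (Tx (j + 1) ω - Ty (j + 1) ω) ^ 2 ∂P) / ε ^ 2)) atTop (nhds 0) := by
    have := ENNReal.tendsto_ofReal (core.div_const (ε ^ 2))
    simpa using this
  refine tendsto_of_tendsto_of_tendsto_of_le_of_le tendsto_const_nhds lim
    (fun j => zero_le) (fun j => ?_)
  have I : Integrable (fun ω => (Tx (j + 1) ω - Ty (j + 1) ω) ^ 2) P := by
    refine tip_int P (((TxM _).sub (TyM _)).pow_const 2) 1 ?_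
    filter_upwards [(MX j).1, (MY j).1] with ω h h'
    rw [abs_pow]
    refine pow_le_one₀ (abs_nonneg _) ?_
    rw [abs_le]; constructor <;> linarith
  have mk := mul_meas_ge_le_integral_of_nonneg (Eventually.of_forall fun ω => sq_nonneg _) I (ε ^ 2)
  have sub : P {ω | ε < |Tx (j + 1) ω - Ty (j + 1) ω|} ≤
      P {ω | ε ^ 2 ≤ (Tx (j + 1) ω - Ty (j + 1) ω) ^ 2} := by
    refine measure_mono fun ω h => ?_
    have h' : ε < |Tx (j + 1) ω - Ty (j + 1) ω| := h
    change ε ^ 2 ≤ (Tx (j + 1) ω - Ty (j + 1) ω) ^ 2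
    rw [← sq_abs (Tx (j + 1) ω - Ty (j + 1) ω)]
    exact pow_le_pow_left₀ hε.le h'.le 2
  refine sub.trans ?_
  rw [ENNReal.le_ofReal_iff_toReal_le (measure_ne_top _ _)
    (div_nonneg (integral_nonneg fun ω => sq_nonneg _) (sq_nonneg _)),
    le_div_iff₀ (by positivity), mul_comm]
  exact mk
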